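/- arXiv:1011.5008 — 7 statements merged into one kernel-verified Lean document; each statement's English description precedes it below -/
import Mathlib

section
/- The major-index generating polynomial over Dyck paths of order n satisfies C_n^{maj}(q) = Σ_{D} q^{maj(D)} = (1/[n+1]_q) * qbinomial(2n, n), where the sum is over all Dyck paths D of order n. -/
/-- A Dyck path of order `n`, encoded as a list of steps (`true` = north,
`false` = east) that never passes strictly below the diagonal. -/
def IsDyckPath (n : ℕ) (l : List Bool) : Prop :=
  l.length = 2 * n ∧ l.count true = n ∧
    ∀ k ≤ l.length, (l.take k).count false ≤ (l.take k).count true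

/-- The major index of a Dyck path: number the `2n` steps `1, 2, …, 2n`
starting from the initial north step; `maj` is the sum of the positions of
those east steps that are immediately followed by a north step. -/
def pathMaj (l : List Bool) : ℕ :=
  ∑ i ∈ Finset.range l.length,
    if l.getD i true = false ∧ l.getD (i + 1) false = true then i + 1 else 0

/-- The `q`-integer `[m]_q = 1 + q + ⋯ + q^(m-1)`. -/
def qInt (q : ℚ) (m : ℕ) : ℚ := ∑ i ∈ Finset.range m, q ^ i

/-- The `q`-factorial `[m]_q! = [m]_q [m-1]_q ⋯ [1]_q`. -/
def qFactorial (q : ℚ) (m : ℕ) : ℚ := ∏ i ∈ Finset.range m, qInt q (i + 1)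

open Classical in
noncomputable def balS (a b : ℕ) : Finset (List Bool) :=
  (List.finite_length_eq Bool (a + b)).toFinset.filter
    (fun l => l.count true = a ∧ l.count false = b ∧
      ∀ k ≤ l.length, (l.take k).count false ≤ (l.take k).count true)

theorem count_tf (l : List Bool) : l.count true + l.count false = l.length := by
  induction l with
  | nil => rfl
  | cons x l ih => cases x <;> simp <;> omega

theorem mem_balS (a b : ℕ) (l : List Bool) : l ∈ balS a b ↔
    l.count true = a ∧ l.count false = b ∧
      ∀ k ≤ l.length, (l.take k).count false ≤ (l.take k).count true := by
  have := count_tf l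
  simp [balS]
  intro h1 h2 _
  omega

theorem bal_append (l : List Bool) (x : Bool) :
    (∀ k ≤ (l ++ [x]).length, ((l ++ [x]).take k).count false ≤ ((l ++ [x]).take k).count true) ↔
    ((∀ k ≤ l.length, (l.take k).count false ≤ (l.take k).count true) ∧
      (l ++ [x]).count false ≤ (l ++ [x]).count true) := by
  constructor
  · intro h
    constructor
    · intro k hk
      have := h k (by simp; omega)
      rwa [List.take_append_of_le_length hk] at this
    · have := h _ le_rfl
      rwa [List.take_length] at this
  · rintro ⟨h1, h2⟩ k hk
    rcases Nat.lt_or_ge l.length k with h | h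
    · rw [List.take_of_length_le (by simp; omega)]; exact h2
    · rw [List.take_append_of_le_length h]; exact h1 k h

theorem maj_append_false (l : List Bool) : pathMaj (l ++ [false]) = pathMaj l := by
  unfold pathMaj
  rw [List.length_append, List.length_singleton, Finset.sum_range_succ]
  have h0 : (l ++ [false]).getD (l.length + 1) false = false := by simp
  rw [h0]
  simp only [Bool.false_eq_true, and_false, if_false, add_zero]
  apply Finset.sum_congr rfl
  intro i hi
  have hi := Finset.mem_range.1 hi
  rw [List.getD_append _ _ _ _ hi]
  congr 3
  rcases Nat.lt_or_ge (i + 1) l.length with h | h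
  · rw [List.getD_append _ _ _ _ h]
  · have : i + 1 = l.length := by omega
    simp [this]

theorem maj_append_true (l : List Bool) : pathMaj (l ++ [true]) =
    pathMaj l + if l.getLast? = some false then l.length else 0 := by
  rcases List.eq_nil_or_concat l with rfl | ⟨l, y, rfl⟩
  · simp [pathMaj]
  · unfold pathMaj
    simp only [List.concat_eq_append]
    rw [List.length_append, List.length_singleton, Finset.sum_range_succ, List.length_append,
      List.length_singleton, Finset.sum_range_succ, Finset.sum_range_succ]
    have h0 : ∀ i ∈ Finset.range l.length,
      (if (l ++ [y] ++ [true]).getD i true = false ∧ (l ++ [y] ++ [true]).getD (i + 1) false = true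
        then i + 1 else 0) =
      (if (l ++ [y]).getD i true = false ∧ (l ++ [y]).getD (i + 1) false = true
        then i + 1 else 0) := by
      intro i hi
      have hi := Finset.mem_range.1 hi
      rw [List.getD_append (l ++ [y]) _ _ _ (by simp; omega),
        List.getD_append (l ++ [y]) _ _ _ (by simp; omega)]
    rw [Finset.sum_congr rfl h0]
    cases y <;> simp [List.getD_eq_getElem?_getD]

noncomputable def bF (q : ℚ) (a b : ℕ) : ℚ := ∑ l ∈ balS a b, q ^ pathMaj l
noncomputable def bE (q : ℚ) (a b : ℕ) : ℚ :=
  ∑ l ∈ balS a b with l.getLast? = some false, q ^ pathMaj l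

theorem bE_succ (q : ℚ) (a b : ℕ) (h : b + 1 ≤ a) : bE q a (b + 1) = bF q a b := by
  unfold bE bF
  symm
  apply Finset.sum_bij (fun l _ => l ++ [false])
  · intro l hl
    rw [mem_balS] at hl
    rw [Finset.mem_filter, mem_balS, bal_append]
    refine ⟨⟨?_, ?_, hl.2.2, ?_⟩, ?_⟩ <;> simp [hl.1, hl.2.1, h]
  · intro l _ l' _ h
    simpa using h
  · intro l hl
    rw [Finset.mem_filter, mem_balS] at hl
    rcases List.eq_nil_or_concat l with rfl | ⟨l, y, rfl⟩
    · simp at hl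
    · simp only [List.concat_eq_append] at hl ⊢
      obtain ⟨⟨h1, h2, h3⟩, h4⟩ := hl
      simp at h4
      subst h4
      rw [bal_append] at h3
      refine ⟨l, ?_, rfl⟩
      rw [mem_balS]
      exact ⟨by simpa using h1, by simpa using h2, h3.1⟩
  · intro l _
    rw [maj_append_false]

theorem bE_zero (q : ℚ) (a : ℕ) : bE q a 0 = 0 := by
  unfold bE
  rw [Finset.filter_false_of_mem]
  · simp
  · intro l hl h
    rw [mem_balS] at hl
    have := List.mem_of_getLast? h
    exact absurd hl.2.1 (List.count_pos_iff.2 this).ne'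

theorem bF_empty (a b : ℕ) (h : a < b) : balS a b = ∅ := by
  ext l
  rw [mem_balS]
  simp only [Finset.notMem_empty, iff_false]
  rintro ⟨h1, h2, h3⟩
  have := h3 _ le_rfl
  rw [List.take_length] at this
  omega

theorem bN_succ (q : ℚ) (a b : ℕ) :
    ∑ l ∈ balS (a + 1) b with ¬ l.getLast? = some false, q ^ pathMaj l =
      ∑ l ∈ balS a b, q ^ pathMaj (l ++ [true]) := by
  symm
  apply Finset.sum_bij (fun l _ => l ++ [true])
  · intro l hl
    rw [mem_balS] at hl
    have h := hl.2.2 _ le_rfl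
    rw [List.take_length] at h
    rw [Finset.mem_filter, mem_balS, bal_append]
    refine ⟨⟨?_, ?_, hl.2.2, ?_⟩, ?_⟩
    · simp [hl.1]
    · simp [hl.2.1]
    · simp; omega
    · simp
  · intro l _ l' _ h
    simpa using h
  · intro l hl
    rw [Finset.mem_filter, mem_balS] at hl
    rcases List.eq_nil_or_concat l with rfl | ⟨l, y, rfl⟩
    · simp at hl
    · simp only [List.concat_eq_append] at hl ⊢
      obtain ⟨⟨h1, h2, h3⟩, h4⟩ := hl
      simp at h4
      subst h4
      rw [bal_append] at h3
      refine ⟨l, ?_, rfl⟩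
      rw [mem_balS]
      exact ⟨by simpa using h1, by simpa using h2, h3.1⟩
  · intro l _
    rfl

theorem bF_rec (q : ℚ) (a b : ℕ) :
    bF q (a + 1) b = bF q a b + (q ^ (a + b) - 1) * bE q a b + bE q (a + 1) b := by
  have h1 : bF q (a + 1) b = bE q (a + 1) b + ∑ l ∈ balS a b, q ^ pathMaj (l ++ [true]) := by
    rw [← bN_succ]
    unfold bF bE
    rw [Finset.sum_filter_add_sum_filter_not]
  have h2 : ∑ l ∈ balS a b, q ^ pathMaj (l ++ [true]) =
      bF q a b + (q ^ (a + b) - 1) * bE q a b := by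
    unfold bF bE
    rw [Finset.mul_sum, Finset.sum_filter, ← Finset.sum_add_distrib]
    apply Finset.sum_congr rfl
    intro l hl
    rw [mem_balS] at hl
    have := count_tf l
    rw [hl.1, hl.2.1] at this
    rw [maj_append_true, ← this]
    split_ifs
    · rw [pow_add]; ring
    · simp
  rw [h1, h2]; ring

theorem bF_zero (q : ℚ) : bF q 0 0 = 1 := by
  have : balS 0 0 = {[]} := by
    ext l
    rw [mem_balS, Finset.mem_singleton]
    constructor
    · rintro ⟨h1, h2, _⟩
      have := count_tf l
      exact List.length_eq_zero_iff.1 (by omega)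
    · rintro rfl
      simp
  simp [bF, this, pathMaj]

theorem qInt_succ (q : ℚ) (m : ℕ) : qInt q (m + 1) = 1 + q * qInt q m := by
  unfold qInt
  rw [Finset.sum_range_succ', Finset.mul_sum, pow_zero, add_comm]
  simp [pow_succ, mul_comm]

theorem qInt_add (q : ℚ) (a b : ℕ) : qInt q (a + b) = qInt q a + q ^ a * qInt q b := by
  unfold qInt
  rw [Finset.sum_range_add, Finset.mul_sum]
  simp [pow_add]

theorem pow_qInt (q : ℚ) (a : ℕ) : q ^ a = 1 + (q - 1) * qInt q a := by
  unfold qInt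
  rw [mul_comm, geom_sum_mul]; ring

theorem qF_succ (q : ℚ) (m : ℕ) : qFactorial q (m + 1) = qFactorial q m * qInt q (m + 1) := by
  unfold qFactorial
  rw [Finset.prod_range_succ]

theorem qF_ne (q : ℚ) (n : ℕ) (hq : ∀ m : ℕ, 1 ≤ m → m ≤ n → qInt q m ≠ 0) :
    qFactorial q n ≠ 0 := by
  unfold qFactorial
  rw [Finset.prod_ne_zero_iff]
  intro i hi
  have := Finset.mem_range.1 hi
  exact hq _ (by omega) (by omega)

theorem bF_closed (q : ℚ) (n : ℕ) (hq : ∀ m : ℕ, 1 ≤ m → m ≤ n + 1 → qInt q m ≠ 0) :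
    ∀ a ≤ n, ∀ b ≤ a, bF q a b = qFactorial q (a + b) * (qInt q (a + 1) - q * qInt q b) /
      (qFactorial q (a + 1) * qFactorial q b) := by
  intro a
  induction a with
  | zero =>
    intro _ b hb
    obtain rfl : b = 0 := by omega
    rw [bF_zero]
    simp [qFactorial, qInt]
  | succ a iha =>
    intro ha b
    have iha := iha (by omega)
    induction b with
    | zero =>
      intro _
      rw [bF_rec, bE_zero, bE_zero, iha 0 (by omega)]
      have h1 := hq (a + 1) (by omega) (by omega)
      have h2 := hq (a + 1 + 1) (by omega) (by omega)
      have h3 := qF_ne q a (fun m h h' => hq m h (by omega))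
      have h4 : qFactorial q 0 = 1 := by simp [qFactorial]
      have h5 : qInt q 0 = 0 := by simp [qInt]
      simp only [add_zero, qF_succ, h4, h5]
      field_simp
      ring
    | succ b ihb =>
      intro hb
      have ihb := ihb (by omega)
      rw [bF_rec, bE_succ _ (a + 1) b hb, ihb]
      have h1 := hq (a + 1) (by omega) (by omega)
      have h2 := hq (a + 1 + 1) (by omega) (by omega)
      have h3 := qF_ne q a (fun m h h' => hq m h (by omega))
      have h4 := hq (b + 1) (by omega) (by omega)
      have h5 := qF_ne q b (fun m h h' => hq m h (by omega))
      rcases Nat.lt_or_ge a (b + 1) with h | h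
      · obtain rfl : b = a := by omega
        have e1 : bF q b (b + 1) = 0 := by simp [bF, bF_empty b (b + 1) (by omega)]
        have e2 : bE q b (b + 1) = 0 := by simp [bE, bF_empty b (b + 1) (by omega)]
        rw [e1, e2]
        have e3 : b + 1 + (b + 1) = (b + 1 + b) + 1 := by omega
        rw [e3, qF_succ q (b + 1 + b), qF_succ q (b + 1), qF_succ q b]
        have e4 : qInt q (b + 1 + b + 1) = qInt q (b + 1) * (qInt q (b + 1 + 1) - q * qInt q b) := by
          rw [show b + 1 + b + 1 = b + 1 + (b + 1) by omega, qInt_add, pow_qInt, qInt_succ q (b+1),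
            qInt_succ q b]
          ring
        rw [e4]
        have e5 : qInt q (b + 1 + 1) - q * qInt q (b + 1) = 1 := by
          rw [qInt_succ q (b + 1)]; ring
        rw [e5]
        field_simp
        ring
      · rw [iha (b + 1) h, bE_succ _ a b h, iha b (by omega)]
        have e1 : a + 1 + (b + 1) = a + b + 1 + 1 := by omega
        have e2 : a + (b + 1) = a + b + 1 := by omega
        have e3 : a + 1 + b = a + b + 1 := by omega
        rw [e1, e2, e3]
        simp only [qF_succ]
        rw [pow_qInt q (a + b + 1)]
        have k1 : qInt q (a + b + 1 + 1) = 1 + q * (1 + q * qInt q (a + b)) := by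
          rw [qInt_succ, qInt_succ]
        have k2 : qInt q (a + b) = qInt q a + (1 + (q - 1) * qInt q a) * qInt q b := by
          rw [qInt_add, pow_qInt]
        have k3 := qInt_succ q (a + b)
        have k4 := qInt_succ q (a + 1)
        have k5 := qInt_succ q a
        have k6 := qInt_succ q b
        rw [k1, k3, k2]
        field_simp
        rw [k4, k5, k6]
        ring

/-- The major-index generating polynomial over Dyck paths of order `n`
satisfies `C_n^{maj}(q) = (1/[n+1]_q) * qbinomial (2n) n`, where
`qbinomial (2n) n = [2n]_q! / ([n]_q! [n]_q!)`. -/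
theorem maj_generating_eq_qcatalan (n : ℕ) (q : ℚ)
    (hq : ∀ m : ℕ, 1 ≤ m → m ≤ 2 * n + 1 → qInt q m ≠ 0) :
    ∑ᶠ d : {l : List Bool // IsDyckPath n l}, q ^ pathMaj d.1 =
      (1 / qInt q (n + 1)) *
        (qFactorial q (2 * n) / (qFactorial q n * qFactorial q n)) := by
  have h1 : ∑ᶠ d : {l : List Bool // IsDyckPath n l}, q ^ pathMaj d.1 = bF q n n := by
    have hS : {l : List Bool | IsDyckPath n l} = ↑(balS n n) := by
      ext l
      have := count_tf l
      rw [Finset.mem_coe, mem_balS, Set.mem_ofPred_eq, IsDyckPath]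
      constructor
      · rintro ⟨h1, h2, h3⟩
        exact ⟨h2, by omega, h3⟩
      · rintro ⟨h1, h2, h3⟩
        exact ⟨by omega, h1, h3⟩
    have := finsum_mem_coe_finset (fun l => q ^ pathMaj l) (balS n n)
    rw [bF, ← this]
    rw [← hS]
    exact finsum_set_coe_eq_finsum_mem (f := fun l => q ^ pathMaj l) {l : List Bool | IsDyckPath n l}
  rw [h1, bF_closed q n (fun m h h' => hq m h (by omega)) n le_rfl n le_rfl]
  have e5 : qInt q (n + 1) - q * qInt q n = 1 := by
    rw [qInt_succ q n]; ring
  have h2 := hq (n + 1) (by omega) (by omega)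
  have h3 := qF_ne q n (fun m h h' => hq m h (by omega))
  rw [e5, qF_succ, two_mul]
  field_simp
end

section
/- For every n, Σ_{D} q^{area(D)} = Σ_{D} q^{bounce(D)}, where both sums range over all Dyck paths D of order n; equivalently, there exists a bijection φ from the set of Dyck paths of order n to itself such that bounce(φ(D)) = area(D) for every Dyck path D. -/
/-- The area of a Dyck path: the number of complete lattice cells lying
between the path and the line `y = x`. -/
def pathArea (l : List Bool) : ℕ :=
  ∑ i ∈ Finset.range l.length,
    if l.getD i true = false then (l.take i).count true - ((l.take i).count false + 1) else 0

/-- The number of east steps taken before the `j`-th north step of the path,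
i.e. the `x`-coordinate at which the path first attains height `j`.  Starting
from the diagonal point `(j, j)`, the bounce path travels west along `y = j`
precisely until this point (the top of a north segment of the path), and then
drops south to the diagonal. -/
def eastsBefore (l : List Bool) (j : ℕ) : ℕ :=
  ∑ i ∈ Finset.range l.length,
    if l.getD i true = false ∧ (l.take i).count true < j then 1 else 0

/-- Auxiliary sum for the bounce statistic: starting at diagonal height `j`,
sum the successive diagonal touch points `eastsBefore l j`,
`eastsBefore l (eastsBefore l j)`, …  (`fuel` iterations suffice since the
sequence strictly decreases to `0`). -/
def bounceAux (l : List Bool) : ℕ → ℕ → ℕ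
  | 0, _ => 0
  | fuel + 1, j => eastsBefore l j + bounceAux l fuel (eastsBefore l j)

/-- The bounce statistic of a Dyck path of order `n`: the bounce path starts
at `(n,n)`, travels west to the path, south to the diagonal, and repeats until
it reaches `(0,0)`; `bounce D` is the sum of the heights `k` of the diagonal
points `(k,k)` it touches (excluding the starting point `(n,n)`). -/
def pathBounce (n : ℕ) (l : List Bool) : ℕ := bounceAux l n n

def dyk : ℕ → List Bool → Prop
  | h, [] => h = 0
  | h, true :: l => dyk (h + 1) l
  | 0, false :: _ => False
  | h + 1, false :: l => dyk h l

def inn : ℕ → List Bool → List Bool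
  | _, [] => []
  | 0, true :: l => inn 1 l
  | h + 1, true :: l => true :: inn (h + 2) l
  | 0, false :: _ => []
  | 1, false :: l => inn 0 l
  | h + 2, false :: l => false :: inn (h + 1) l

def wd : ℕ → List Bool → List Bool
  | _, [] => []
  | 0, true :: l => true :: wd 1 l
  | 1, true :: l => false :: wd 2 l
  | h + 2, true :: l => wd (h + 3) l
  | 0, false :: _ => []
  | h + 1, false :: l => wd h l

def ar : ℕ → List Bool → ℕ
  | _, [] => 0
  | h, true :: l => ar (h + 1) l
  | h, false :: l => (h - 1) + ar (h - 1) l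

def rp : ℕ → List Bool → List Bool
  | 0, _ => []
  | f + 1, l => wd 0 l ++ rp f (inn 0 l)

def phi (f : ℕ) (l : List Bool) : List Bool :=
  (List.replicate ((wd 0 l).count true) false ++ rp f l).reverse

theorem dyk_inn (l : List Bool) : ∀ h, dyk h l → dyk (h - 1) (inn h l) := by
  induction l with
  | nil => intro h; simp [dyk, inn]; omega
  | cons a l ih =>
    intro h hd
    cases a <;> rcases h with _ | _ | h <;> simp_all [dyk, inn]
    · simpa using ih 0 hd
    · simpa using ih _ hd
    · simpa using ih 1 hd
    · simpa using ih 2 hd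
    · simpa using ih _ hd

theorem ct_wd (l : List Bool) : ∀ h, dyk h l →
    (wd h l).count true + (inn h l).count true = l.count true := by
  induction l with
  | nil => intro h; simp [wd, inn]
  | cons a l ih =>
    intro h hd
    cases a <;> rcases h with _ | _ | h <;> simp_all [dyk, inn, wd] <;>
      have := ih _ hd <;> (try simp only [add_assoc, Nat.reduceAdd] at *) <;> omega

theorem cf_wd (l : List Bool) : ∀ h, dyk h l →
    (wd (h - 1) (inn h l)).count true = (wd h l).count false := by
  induction l with
  | nil => intro h; simp [wd, inn]
  | cons a l ih =>
    intro h hd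
    cases a <;> rcases h with _ | _ | _ | h <;> simp_all [dyk, inn, wd] <;>
      (have := ih _ hd; simpa using this)

theorem ar_inn (l : List Bool) : ∀ h, dyk h l →
    ar h l = ar (h - 1) (inn h l) + (inn h l).count false := by
  induction l with
  | nil => intro h; simp [ar, inn]
  | cons a l ih =>
    intro h hd
    cases a <;> rcases h with _ | _ | h <;> simp_all [dyk, inn, ar]
    omega

theorem wd_head (l : List Bool) (h : dyk 0 l) : l = [] ∨ ∃ w, wd 0 l = true :: w := by
  rcases l with _ | ⟨_ | _, l⟩ <;> simp_all [dyk, wd]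

theorem inj_aux (l : List Bool) : ∀ h m, dyk h l → dyk h m → inn h l = inn h m →
    wd h l = wd h m → l = m := by
  induction l with
  | nil =>
    intro h m hl hm hi hw
    simp only [dyk] at hl
    subst hl
    rcases wd_head m hm with h | ⟨w, h⟩
    · exact h.symm
    · simp [wd, h] at hw
  | cons a l ih =>
    intro h m hl hm hi hw
    rcases m with _ | ⟨b, m⟩
    · simp only [dyk] at hm
      subst hm
      rcases wd_head _ hl with h | ⟨w, h⟩
      · exact h
      · simp [wd, h] at hw
    · cases a <;> cases b <;> rcases h with _ | _ | h <;> simp_all [dyk, inn, wd]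
      all_goals first
        | exact ih _ _ hl hm hi hw
        | (rcases wd_head _ hl with h | ⟨w, h⟩ <;> simp_all [wd])
        | (rcases wd_head _ hm with h | ⟨w, h⟩ <;> simp_all [wd])

theorem dyk_bal (l : List Bool) : ∀ h, dyk h l → l.count false = l.count true + h := by
  induction l with
  | nil => intro h; simp [dyk, eq_comm]
  | cons a l ih =>
    intro h hd
    cases a <;> rcases h with _ | h <;> simp_all [dyk] <;> have := ih _ hd <;> omega

theorem dyk_of (l : List Bool) : ∀ h, l.count false = l.count true + h →
    (∀ k ≤ l.length, (l.take k).count false ≤ (l.take k).count true + h) → dyk h l := by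
  induction l with
  | nil => intro h; simp [dyk, eq_comm]
  | cons a l ih =>
    intro h hb hp
    have hp' : ∀ k ≤ l.length, ((a :: l).take (k+1)).count false ≤
        ((a :: l).take (k+1)).count true + h := fun k hk => hp (k+1) (by simpa using hk)
    cases a
    · rcases h with _ | h
      · have := hp' 0 (by simp)
        simp at this
      · simp only [dyk]
        apply ih
        · simp at hb; omega
        · intro k hk
          have := hp' k hk
          simp at this; omega
    · simp only [dyk]
      apply ih
      · simp at hb; omega
      · intro k hk
        have := hp' k hk
        simp at this; omega

theorem ar_eq (l : List Bool) : ∀ h, ∑ i ∈ Finset.range l.length,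
    (if l.getD i true = false then (l.take i).count true + h - ((l.take i).count false + 1) else 0)
      = ar h l ∨ ¬ dyk h l := by
  induction l with
  | nil => intro h; simp [ar]
  | cons a l ih =>
    intro h
    rw [List.length_cons, Finset.sum_range_succ']
    cases a
    · rcases h with _ | h
      · right; simp [dyk]
      · rcases ih h with e | e
        · left
          simp only [ar, Nat.add_sub_cancel, ← e]
          rw [add_comm]
          simp
          refine Finset.sum_congr rfl fun i _ => ?_
          split_ifs <;> omega
        · right; simpa [dyk] using e
    · rcases ih (h+1) with e | e
      · left
        simp only [ar, ← e]
        simp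
        refine Finset.sum_congr rfl fun i _ => ?_
        split_ifs <;> omega
      · right; simpa [dyk] using e

theorem inn_zero_nil : inn 0 [] = [] := rfl

theorem rp_nil (f : ℕ) : rp f [] = [] := by
  induction f with
  | zero => rfl
  | succ f ih => simp [rp, wd, inn, ih]

theorem eq_nil_of (l : List Bool) (h : dyk 0 l) (h0 : l.count true = 0) : l = [] := by
  have := dyk_bal l 0 h
  have h2 := List.count_true_add_count_false l
  exact List.length_eq_zero_iff.1 (by omega)

theorem ct_inn_le (l : List Bool) (h : dyk 0 l) (f : ℕ) (hf : l.count true ≤ f + 1) :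
    (inn 0 l).count true ≤ f := by
  rcases wd_head l h with rfl | ⟨w, hw⟩
  · simp [inn]
  · have := ct_wd l 0 h
    rw [hw] at this
    simp at this; omega

theorem rp_counts (f : ℕ) : ∀ l, dyk 0 l → l.count true ≤ f →
    (rp f l).count true = l.count true ∧
    (rp f l).count false + (wd 0 l).count true = l.count true := by
  induction f with
  | zero =>
    intro l h h0
    obtain rfl := eq_nil_of l h (by omega)
    simp [rp, wd]
  | succ f ih =>
    intro l h hf
    have h1 := ih (inn 0 l) (dyk_inn l 0 h) (ct_inn_le l h f hf)
    have h2 := ct_wd l 0 h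
    have h3 := cf_wd l 0 h
    simp only [Nat.zero_sub] at h3
    simp only [rp, List.count_append]
    omega

theorem suffix_append_cases {a b s : List Bool} (h : s <:+ a ++ b) :
    s <:+ b ∨ ∃ x, x <:+ a ∧ s = x ++ b := by
  obtain ⟨t, ht⟩ := h
  rcases List.append_eq_append_iff.1 ht with ⟨x, h1, h2⟩ | ⟨x, h1, h2⟩
  · exact Or.inr ⟨x, ⟨t, h1.symm⟩, h2⟩
  · exact Or.inl ⟨x, h2.symm⟩

theorem rp_suffix (f : ℕ) : ∀ l, dyk 0 l → l.count true ≤ f →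
    ∀ s, s <:+ (List.replicate ((wd 0 l).count true) false ++ rp f l) →
      s.count false ≤ s.count true := by
  induction f with
  | zero =>
    intro l h h0
    obtain rfl := eq_nil_of l h (by omega)
    simp [rp, wd]
  | succ f ih =>
    intro l h hf s hs
    have hle := ct_inn_le l h f hf
    have h1 := rp_counts f (inn 0 l) (dyk_inn l 0 h) hle
    have h2 := ct_wd l 0 h
    have h3 := cf_wd l 0 h
    simp only [Nat.zero_sub] at h3
    rw [rp, ← List.append_assoc] at hs
    rcases suffix_append_cases hs with hs | ⟨x, hx, rfl⟩
    · exact ih _ (dyk_inn l 0 h) hle s (hs.trans (List.suffix_append _ _))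
    · rcases suffix_append_cases hx with hx | ⟨y, hy, rfl⟩
      · have := hx.sublist.count_le false
        simp only [List.count_append]
        omega
      · have := hy.sublist.count_le false
        simp only [List.count_replicate_self] at this
        simp only [List.count_append]
        omega

theorem phi_dyck (n : ℕ) (l : List Bool) (h : dyk 0 l) (hn : l.count true = n) :
    IsDyckPath n (phi n l) := by
  have h1 := rp_counts n l h hn.le
  have ht : (phi n l).count true = n := by
    simp [phi, List.count_append, List.count_replicate]; omega
  have hf : (phi n l).count false = n := by
    simp [phi, List.count_append]; omega
  refine ⟨?_, ht, ?_⟩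
  · have := List.count_true_add_count_false (phi n l)
    omega
  · intro k _
    have := rp_suffix n l h hn.le ((phi n l).take k).reverse (by
      have : ((phi n l).take k).reverse <:+ (phi n l).reverse :=
        List.reverse_suffix.2 (List.take_prefix _ _)
      simpa [phi] using this)
    simpa using this

theorem rp_head (f : ℕ) (l : List Bool) (h : dyk 0 l) : (rp f l).head? ≠ some false := by
  rcases f with _ | f
  · simp [rp]
  · rcases wd_head l h with rfl | ⟨w, hw⟩
    · simp [rp_nil]
    · simp [rp, hw]

theorem split_inj (w : List Bool) : ∀ v x y : List Bool, w.count true = v.count true →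
    x.head? ≠ some false → y.head? ≠ some false → w ++ x = v ++ y → w = v ∧ x = y := by
  induction w with
  | nil =>
    intro v x y hc hx hy h
    rcases v with _ | ⟨_ | _, v⟩
    · simpa using h
    · simp at h; simp [h] at hx
    · simp at hc
  | cons a w ih =>
    intro v x y hc hx hy h
    rcases v with _ | ⟨b, v⟩
    · cases a
      · simp at h; simp [← h] at hy
      · simp at hc
    · simp only [List.cons_append, List.cons.injEq] at h
      obtain ⟨rfl, h⟩ := h
      have := ih v x y (by cases a <;> simpa using hc) hx hy h
      simpa using this

theorem rp_inj (f : ℕ) : ∀ l m, dyk 0 l → dyk 0 m → l.count true ≤ f → m.count true ≤ f →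
    (wd 0 l).count true = (wd 0 m).count true → rp f l = rp f m → l = m := by
  induction f with
  | zero =>
    intro l m hl hm h1 h2 _ _
    rw [eq_nil_of l hl (by omega), eq_nil_of m hm (by omega)]
  | succ f ih =>
    intro l m hl hm h1 h2 hw hr
    obtain ⟨e1, e2⟩ := split_inj _ _ _ _ hw (rp_head f _ (dyk_inn l 0 hl))
      (rp_head f _ (dyk_inn m 0 hm)) hr
    refine inj_aux l 0 m hl hm ?_ e1
    refine ih _ _ (dyk_inn l 0 hl) (dyk_inn m 0 hm) (ct_inn_le l hl f h1) (ct_inn_le m hm f h2) ?_ e2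
    have h3 := cf_wd l 0 hl
    have h4 := cf_wd m 0 hm
    simp only [Nat.zero_sub] at h3 h4
    rw [h3, h4, e1]

theorem phi_inj (f : ℕ) (l m : List Bool) (hl : dyk 0 l) (hm : dyk 0 m) (h1 : l.count true ≤ f)
    (h2 : m.count true ≤ f) (h : phi f l = phi f m) : l = m := by
  have h := List.reverse_injective h
  obtain ⟨e1, e2⟩ := split_inj _ _ _ _ (by simp [List.count_replicate]) (rp_head f l hl)
    (rp_head f m hm) h
  exact rp_inj f l m hl hm h1 h2 (by simpa using congrArg List.length e1) e2

theorem eb_snoc (l : List Bool) (a : Bool) (j : ℕ) : eastsBefore (l ++ [a]) j =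
    eastsBefore l j + if a = false ∧ l.count true < j then 1 else 0 := by
  unfold eastsBefore
  rw [List.length_append, List.length_singleton, Finset.sum_range_succ]
  congr 1
  · refine Finset.sum_congr rfl fun i hi => ?_
    have hi := Finset.mem_range.1 hi
    rw [List.getD_append _ _ _ _ hi, List.take_append_of_le_length hi.le]
  · simp

theorem eb_append (l m : List Bool) (j : ℕ) (h : j ≤ l.count true) :
    eastsBefore (l ++ m) j = eastsBefore l j := by
  induction m using List.reverseRecOn with
  | nil => simp
  | append_singleton m a ih =>
    rw [← List.append_assoc, eb_snoc, ih, if_neg]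
    · rfl
    · simp; omega

theorem eb_le (l : List Bool) (j : ℕ) : eastsBefore l j ≤ l.count false := by
  induction l using List.reverseRecOn with
  | nil => simp [eastsBefore]
  | append_singleton m a ih =>
    rw [eb_snoc]
    cases a <;> simp <;> (try split_ifs) <;> omega

theorem eb_eq (l : List Bool) (j : ℕ) (h : l.count true < j) : eastsBefore l j = l.count false := by
  induction l using List.reverseRecOn with
  | nil => simp [eastsBefore]
  | append_singleton m a ih =>
    simp at h
    rw [eb_snoc, ih (by omega)]
    cases a <;> simp <;> omega

theorem bounce_congr (l m : List Bool) (n : ℕ) (h : ∀ j ≤ n, eastsBefore l j = eastsBefore m j)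
    (hb : ∀ j, eastsBefore m j ≤ n) (g : ℕ) : ∀ j ≤ n, bounceAux l g j = bounceAux m g j := by
  induction g with
  | zero => intro j _; rfl
  | succ g ih =>
    intro j hj
    simp only [bounceAux]
    rw [h j hj, ih _ (hb j)]

theorem bounce_nil (g j : ℕ) : bounceAux [] g j = 0 := by
  induction g generalizing j with
  | zero => rfl
  | succ g ih => simp [bounceAux, ih, eastsBefore]

theorem phi_nil (f : ℕ) : phi f [] = [] := by simp [phi, wd, rp_nil]

theorem bounce_phi (f : ℕ) : ∀ l g, dyk 0 l → l.count true ≤ f → l.count true ≤ g →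
    bounceAux (phi f l) g (l.count true) = ar 0 l := by
  induction f with
  | zero =>
    intro l g h h0 _
    obtain rfl := eq_nil_of l h (by omega)
    simp [phi_nil, bounce_nil, ar]
  | succ f ih =>
    intro l g h hf hg
    rcases wd_head l h with rfl | ⟨w, hw⟩
    · simp [phi_nil, bounce_nil, ar]
    have hle := ct_inn_le l h f hf
    have hi := dyk_inn l 0 h
    simp only [Nat.zero_sub] at hi
    have h1 := rp_counts f (inn 0 l) hi hle
    have h2 := ct_wd l 0 h
    have h3 := cf_wd l 0 h
    have h4 := ar_inn l 0 h
    have h5 := dyk_bal _ _ hi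
    simp only [Nat.zero_sub] at h3 h4
    have hk : (wd 0 l).count true = w.count true + 1 := by simp [hw]
    have hk' : (wd 0 l).count false = w.count false := by simp [hw]
    rcases g with _ | g
    · omega
    have ephi : phi (f+1) l = (rp f (inn 0 l)).reverse ++ (w.reverse ++ ([true] ++
        List.replicate ((wd 0 l).count true) false)) := by
      simp [phi, rp, hw]
    have e1 : eastsBefore (phi (f+1) l) (l.count true) = (inn 0 l).count true := by
      have : phi (f+1) l = ((rp f (inn 0 l)).reverse ++ w.reverse ++ [true]) ++
        List.replicate ((wd 0 l).count true) false := by simp [ephi]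
      rw [this, eb_append _ _ _ (by simp; omega), eb_snoc, eb_eq _ _ (by simp; omega)]
      simp; omega
    have hcf : (phi f (inn 0 l)).count false = (inn 0 l).count true := by
      simp [phi]; omega
    rw [bounceAux, e1, bounce_congr _ (phi f (inn 0 l)) ((inn 0 l).count true) ?_ ?_ g _ le_rfl,
      ih _ g hi hle (by omega)]
    · omega
    · intro j hj
      rw [ephi, eb_append _ _ _ (by simp; omega), phi, List.reverse_append,
        eb_append _ _ _ (by simp; omega)]
    · intro j
      rw [← hcf]; exact eb_le _ _

theorem IsDyckPath.dyk {n : ℕ} {l : List Bool} (h : IsDyckPath n l) : dyk 0 l := by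
  obtain ⟨h1, h2, h3⟩ := h
  have := List.count_true_add_count_false l
  exact dyk_of l 0 (by omega) (by simpa using h3)

theorem finite_dyck (n : ℕ) : Finite {l : List Bool // IsDyckPath n l} := by
  have : {l : List Bool | IsDyckPath n l}.Finite :=
    (List.finite_length_eq Bool (2 * n)).subset fun l h => h.1
  exact this

/-- The area and bounce statistics are equidistributed over Dyck paths of
order `n`: `∑_D q^(area D) = ∑_D q^(bounce D)`; equivalently there is a
bijection `φ` on Dyck paths of order `n` with `bounce (φ D) = area D`. -/
theorem area_bounce_equidistributed (n : ℕ) :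
    (∀ q : ℚ,
        ∑ᶠ d : {l : List Bool // IsDyckPath n l}, q ^ pathArea d.1 =
          ∑ᶠ d : {l : List Bool // IsDyckPath n l}, q ^ pathBounce n d.1) ∧
    ∃ φ : {l : List Bool // IsDyckPath n l} ≃ {l : List Bool // IsDyckPath n l},
      ∀ d, pathBounce n (φ d).1 = pathArea d.1 := by
  have hex : ∃ φ : {l : List Bool // IsDyckPath n l} ≃ {l : List Bool // IsDyckPath n l},
      ∀ d, pathBounce n (φ d).1 = pathArea d.1 := by
    have := finite_dyck n
    let F : {l : List Bool // IsDyckPath n l} → {l : List Bool // IsDyckPath n l} :=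
      fun d => ⟨phi n d.1, phi_dyck n d.1 d.2.dyk d.2.2.1⟩
    have hF : Function.Injective F := fun a b hab => Subtype.ext
      (phi_inj n a.1 b.1 a.2.dyk b.2.dyk a.2.2.1.le b.2.2.1.le (congrArg Subtype.val hab))
    refine ⟨Equiv.ofBijective F (Finite.injective_iff_bijective.1 hF), fun d => ?_⟩
    have h1 := bounce_phi n d.1 n d.2.dyk d.2.2.1.le d.2.2.1.le
    rw [d.2.2.1] at h1
    have h2 := (ar_eq d.1 0).resolve_right (not_not.2 d.2.dyk)
    exact h1.trans h2.symm
  refine ⟨fun q => ?_, hex⟩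
  obtain ⟨φ, hφ⟩ := hex
  rw [← finsum_comp_equiv φ (f := fun d => q ^ pathBounce n d.1)]
  exact finsum_congr fun d => by rw [hφ]
end

section
/- The number of maximal chains in the poset of Dyck paths of order n ordered by inclusion equals binomial(n,2)! / Π_{i=1}^{n-1} (2i-1)^{n-i}. -/
structure DyckPath (n : ℕ) where
  toList : List Bool
  length_eq : toList.length = 2 * n
  count_true : toList.count true = n
  diag : ∀ k ≤ toList.length, (toList.take k).count false ≤ (toList.take k).count true

instance (n : ℕ) : PartialOrder (DyckPath n) where
  le d₁ d₂ := ∀ k, (d₁.toList.take k).count true ≤ (d₂.toList.take k).count true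
  le_refl _ _ := le_rfl
  le_trans _ _ _ h₁ h₂ k := (h₁ k).trans (h₂ k)
  le_antisymm a b h₁ h₂ := by
    have hc : ∀ k, (a.toList.take k).count true = (b.toList.take k).count true :=
      fun k => le_antisymm (h₁ k) (h₂ k)
    have hlen : a.toList.length = b.toList.length := by rw [a.length_eq, b.length_eq]
    have hl : a.toList = b.toList := by
      apply List.ext_getElem hlen
      intro i hi hib
      have h1 := hc i
      have h2 := hc (i + 1)
      rw [List.take_succ, List.take_succ, List.count_append, List.count_append, h1] at h2
      have h2' : (a.toList[i]?.toList).count true = (b.toList[i]?.toList).count true := by omega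
      rw [List.getElem?_eq_getElem hi, List.getElem?_eq_getElem hib] at h2'
      simp only [Option.toList_some] at h2'
      cases ha : a.toList[i] <;> cases hb : b.toList[i] <;> simp_all [List.count_cons]
    cases a; cases b; cases hl; rfl

namespace DyckAux

/-- maximal chains of the up-set of `d` -/
def MC {P : Type*} [PartialOrder P] (d : P) : Set (Set P) :=
  {s | (∀ x ∈ s, d ≤ x) ∧ IsChain (· ≤ ·) s ∧
    ∀ t : Set P, (∀ x ∈ t, d ≤ x) → IsChain (· ≤ ·) t → s ⊆ t → s = t}

theorem mem_of_comparable {P : Type*} [PartialOrder P] {d : P} {s : Set P} (hs : s ∈ MC d)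
    {c : P} (hc : d ≤ c) (h : ∀ x ∈ s, c ≤ x ∨ x ≤ c) : c ∈ s := by
  have h1 : s = insert c s := by
    apply hs.2.2
    · intro x hx
      rcases hx with rfl | hx
      · exact hc
      · exact hs.1 x hx
    · exact hs.2.1.insert (fun b hb _ => h b hb)
    · exact Set.subset_insert _ _
  rw [h1]; exact Set.mem_insert _ _

theorem self_mem {P : Type*} [PartialOrder P] {d : P} {s : Set P} (hs : s ∈ MC d) : d ∈ s :=
  mem_of_comparable hs le_rfl (fun x hx => Or.inl (hs.1 x hx))

theorem mem_MC_iff {P : Type*} [PartialOrder P] [Finite P] {t d : P} (ht : ∀ x, x ≤ t)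
    (hd : d ≠ t) (s : Set P) :
    s ∈ MC d ↔ ∃ e, d ⋖ e ∧ ∃ u ∈ MC e, insert d u = s := by
  constructor
  · intro hs
    have hds := self_mem hs
    have hts : t ∈ s := mem_of_comparable hs (ht d) (fun x _ => Or.inr (ht x))
    have hne : (s \ {d}).Nonempty := ⟨t, hts, fun h => hd h.symm⟩
    obtain ⟨e, he⟩ := (Set.toFinite (s \ {d})).exists_minimal hne
    have hemin : ∀ x ∈ s \ {d}, e ≤ x := by
      intro x hx
      rcases hs.2.1.total he.prop.1 hx.1 with h | h
      · exact h
      · exact he.le_of_le hx h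
    have hde : d < e := lt_of_le_of_ne (hs.1 e he.prop.1) (fun h => he.prop.2 h.symm)
    refine ⟨e, ⟨hde, ?_⟩, s \ {d}, ⟨hemin, hs.2.1.mono Set.sdiff_subset, ?_⟩, ?_⟩
    · intro c hdc hce
      have hcs : c ∈ s := by
        apply mem_of_comparable hs hdc.le
        intro x hx
        by_cases hxd : x = d
        · right; rw [hxd]; exact hdc.le
        · left; exact hce.le.trans (hemin x ⟨hx, hxd⟩)
      exact absurd (hemin c ⟨hcs, fun h => hdc.ne' h⟩) (not_le_of_gt hce)
    · intro v hv hvc hsv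
      have hdv : d ∉ v := fun h => absurd (hv d h) (not_le_of_gt hde)
      have : s = insert d v := by
        apply hs.2.2
        · intro x hx
          rcases hx with rfl | hx
          · exact le_rfl
          · exact hde.le.trans (hv x hx)
        · exact hvc.insert (fun b hb _ => Or.inl (hde.le.trans (hv b hb)))
        · intro x hx
          by_cases hxd : x = d
          · left; exact hxd
          · right; exact hsv ⟨hx, hxd⟩
      rw [this]
      exact Set.insert_sdiff_self_of_notMem hdv
    · rw [Set.insert_sdiff_singleton, Set.insert_eq_of_mem hds]
  · rintro ⟨e, hde, u, hu, rfl⟩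
    have heu := self_mem hu
    refine ⟨?_, ?_, ?_⟩
    · intro x hx
      rcases hx with rfl | hx
      · exact le_rfl
      · exact hde.le.trans (hu.1 x hx)
    · exact hu.2.1.insert (fun b hb _ => Or.inl (hde.le.trans (hu.1 b hb)))
    · intro v hv hvc huv
      have h1 : u = v \ {d} := by
        apply hu.2.2
        · rintro x ⟨hx, hxd⟩
          rcases hvc.total hx (huv (Set.mem_insert_of_mem _ heu)) with h | h
          · rcases hde.eq_or_eq (hv x hx) h with h2 | h2
            · exact absurd h2 hxd
            · exact h2.ge
          · exact h
        · exact hvc.mono Set.sdiff_subset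
        · intro x hx
          refine ⟨huv (Set.mem_insert_of_mem _ hx), ?_⟩
          intro h
          have := hu.1 x hx
          rw [Set.mem_singleton_iff.1 h] at this
          exact absurd this (not_le_of_gt hde.lt)
      rw [h1, Set.insert_sdiff_singleton, Set.insert_eq_of_mem (huv (Set.mem_insert _ _))]

open Classical in
theorem card_MC {P : Type*} [PartialOrder P] [Fintype P] {t : P} (ht : ∀ x, x ≤ t)
    (g : P → ℚ) (g1 : g t = 1)
    (hg : ∀ d, d ≠ t → g d = ∑ e ∈ Finset.univ.filter (fun e => d ⋖ e), g e) (d : P) :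
    (((MC d).toFinset.card : ℕ) : ℚ) = g d := by
  induction d using WellFoundedGT.induction with
  | ind d ih =>
  by_cases hd : d = t
  · subst hd
    rw [g1]
    have : (MC d).toFinset = {{d}} := by
      ext s
      simp only [Set.mem_toFinset, Finset.mem_singleton]
      constructor
      · intro hs
        ext x
        constructor
        · intro hx; exact le_antisymm (ht x) (hs.1 x hx)
        · intro hx; rw [Set.mem_singleton_iff.1 hx]; exact self_mem hs
      · rintro rfl
        refine ⟨fun x hx => (Set.mem_singleton_iff.1 hx).ge, IsChain.singleton, ?_⟩
        intro v hv _ hsv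
        ext x
        constructor
        · intro hx; exact hsv hx
        · intro hx; exact le_antisymm (ht x) (hv x hx)
    rw [this]; simp
  · rw [hg d hd]
    have : (MC d).toFinset = (Finset.univ.filter (fun e => d ⋖ e)).biUnion
        (fun e => (MC e).toFinset.image (fun u => insert d u)) := by
      ext s
      simp only [Set.mem_toFinset, Finset.mem_biUnion, Finset.mem_filter, Finset.mem_univ,
        true_and, Finset.mem_image]
      exact mem_MC_iff ht hd s
    have hnot : ∀ e, d ⋖ e → ∀ u ∈ MC e, d ∉ u := by
      intro e he u hu h
      exact absurd (hu.1 d h) (not_le_of_gt he.lt)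
    have hinj : ∀ u v : Set P, d ∉ u → d ∉ v → insert d u = insert d v → u = v := by
      intro u v hu hv h
      rw [← Set.insert_sdiff_self_of_notMem hu, h, Set.insert_sdiff_self_of_notMem hv]
    rw [this, Finset.card_biUnion, Nat.cast_sum]
    · apply Finset.sum_congr rfl
      intro e he
      have he' : d ⋖ e := by simpa using he
      rw [Finset.card_image_of_injOn, ih e he'.lt]
      intro u hu v hv h
      exact hinj u v (hnot e he' u (by simpa using hu)) (hnot e he' v (by simpa using hv)) h
    · intro e he e' he' hne
      refine Finset.disjoint_left.2 ?_
      intro s hs hs'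
      simp only [Finset.mem_image, Set.mem_toFinset] at hs hs'
      obtain ⟨u, hu, rfl⟩ := hs
      obtain ⟨v, hv, h⟩ := hs'
      have he : d ⋖ e := by simpa using he
      have he' : d ⋖ e' := by simpa using he'
      have huv : v = u := hinj v u (hnot e' he' v hv) (hnot e he u hu) h
      subst huv
      exact hne (le_antisymm (hu.1 _ (self_mem hv)) (hv.1 _ (self_mem hu)))

theorem card_maxChain {P : Type*} [PartialOrder P] [Finite P] {t b : P} (ht : ∀ x, x ≤ t)
    (hb : ∀ x, b ≤ x) (g : P → ℚ) (g1 : g t = 1)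
    (hg : ∀ d, d ≠ t → ∀ S : Finset P, (∀ e, e ∈ S ↔ d ⋖ e) → g d = ∑ e ∈ S, g e) :
    ((Nat.card {s : Set P // IsMaxChain (· ≤ ·) s} : ℕ) : ℚ) = g b := by
  classical
  have := Fintype.ofFinite P
  rw [← card_MC ht g g1 (fun d hd => hg d hd _ (by simp)) b]
  congr 1
  rw [Set.toFinset_card, ← Nat.card_eq_fintype_card]
  apply Nat.card_congr
  apply Equiv.subtypeEquivRight
  intro s
  constructor
  · intro h
    exact ⟨fun x _ => hb x, h.1, fun t _ ht hst => h.2 ht hst⟩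
  · intro h
    exact ⟨h.2.1, fun t ht hst => h.2.2 t (fun x _ => hb x) ht hst⟩

end DyckAux

namespace DyckAux
open Matrix Finset

theorem sum_det_updateRow_mul {n : ℕ} (M : Matrix (Fin n) (Fin n) ℚ) (c : Fin n → ℚ) :
    ∑ i, (M.updateRow i (fun j => c j * M i j)).det = (∑ j, c j) * M.det := by
  simp only [Matrix.det_apply']
  rw [Finset.sum_comm, Finset.mul_sum]
  apply Finset.sum_congr rfl
  intro σ _
  have : ∀ i, ∏ k, (M.updateRow i (fun j => c j * M i j)) (σ k) k
      = c (σ.symm i) * ∏ k, M (σ k) k := by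
    intro i
    rw [← Finset.mul_prod_erase _ _ (Finset.mem_univ (σ.symm i)),
      ← Finset.mul_prod_erase _ (fun k => M (σ k) k) (Finset.mem_univ (σ.symm i))]
    simp only [Equiv.apply_symm_apply, updateRow_self, mul_assoc]
    congr 2
    apply Finset.prod_congr rfl
    intro k hk
    rw [updateRow_ne]
    intro h
    apply (Finset.mem_erase.1 hk).1
    rw [← h]; simp
  simp only [this]
  rw [← Finset.mul_sum, ← Finset.sum_mul, Equiv.sum_comp σ.symm c]
  ring

/-- The matrix of falling factorials. -/
def DM {n : ℕ} (f : Fin n → ℕ) : Matrix (Fin n) (Fin n) ℚ :=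
  Matrix.of fun i j => ((f i).descFactorial j : ℚ)

theorem det_DM {n : ℕ} (f : Fin n → ℕ) :
    (DM f).det = ∏ i : Fin n, ∏ j ∈ Ioi i, ((f j : ℚ) - f i) := by
  rw [← Matrix.det_vandermonde (fun i => (f i : ℚ)),
    Matrix.det_eval_matrixOfPolynomials_eq_det_vandermonde _ (fun j => descPochhammer ℚ j)
      (fun i => descPochhammer_natDegree ℚ i) (fun i => monic_descPochhammer ℚ i)]
  congr 1
  ext i j
  simp [DM, descPochhammer_eval_eq_descFactorial]

theorem key {n : ℕ} (f : Fin n → ℕ) :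
    ∑ i, (f i : ℚ) * (DM (Function.update f i (f i - 1))).det
      = (∑ i, (f i : ℚ) - ∑ i : Fin n, ((i : ℕ) : ℚ)) * (DM f).det := by
  have h1 : ∀ i, (f i : ℚ) * (DM (Function.update f i (f i - 1))).det
      = (f i : ℚ) * (DM f).det
        - ((DM f).updateRow i (fun j => ((j : ℕ) : ℚ) * DM f i j)).det := by
    intro i
    have e1 : DM (Function.update f i (f i - 1)) = (DM f).updateRow i
        (fun j => ((f i - 1).descFactorial j : ℚ)) := by
      ext a b
      by_cases h : a = i
      · subst h; simp [DM]
      · simp [DM, h]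
    rw [e1, ← Matrix.det_updateRow_smul, eq_sub_iff_add_eq, ← Matrix.det_updateRow_add]
    have e2 : ((f i : ℚ) • (fun j : Fin n => ((f i - 1).descFactorial j : ℚ)))
        + (fun j : Fin n => ((j : ℕ) : ℚ) * DM f i j) = (f i : ℚ) • DM f i := by
      ext j
      simp only [Pi.add_apply, Pi.smul_apply, smul_eq_mul, DM, Matrix.of_apply]
      rcases Nat.eq_zero_or_pos (f i) with h0 | h0
      · rw [h0]
        rcases Nat.eq_zero_or_pos (j : ℕ) with h | h
        · simp [h]
        · simp [Nat.descFactorial_of_lt h]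
      · obtain ⟨m, hm⟩ := Nat.exists_eq_succ_of_ne_zero h0.ne'
        rw [hm]
        have a1 := Nat.succ_descFactorial_succ m j
        have a2 := Nat.descFactorial_succ (m+1) j
        rw [a1] at a2
        simp only [Nat.succ_eq_add_one, Nat.add_sub_cancel]
        by_cases hj : (j : ℕ) ≤ m + 1
        · have a3 : (((m+1 : ℕ) * m.descFactorial j : ℕ) : ℚ) = (((m + 1 - (j:ℕ)) * (m+1).descFactorial j : ℕ) : ℚ) := by rw [a2]
          push_cast [Nat.cast_sub hj] at a3 ⊢
          linarith
        · push Not at hj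
          rw [Nat.descFactorial_of_lt hj, Nat.descFactorial_of_lt (by omega)]
          simp
    rw [e2, Matrix.det_updateRow_smul, Matrix.updateRow_eq_self]
  rw [Finset.sum_congr rfl (fun i _ => h1 i), Finset.sum_sub_distrib, ← Finset.sum_mul,
    sum_det_updateRow_mul]
  ring

/-- The hook-type formula. -/
noncomputable def G {n : ℕ} (f : Fin n → ℕ) : ℚ :=
  ((∑ i, (f i - (i : ℕ))).factorial : ℚ) / (∏ i, ((f i).factorial : ℚ)) * (DM f).det

theorem le_of_strictMono {n : ℕ} {f : Fin n → ℕ} (hf : StrictMono f) (i : Fin n) :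
    (i : ℕ) ≤ f i := by
  obtain ⟨i, hi⟩ := i
  induction i with
  | zero => simp
  | succ k ih =>
    have := ih (by omega)
    have h2 : f ⟨k, by omega⟩ < f ⟨k+1, hi⟩ := hf (by simp)
    simp only at *
    omega

theorem G_eq {n : ℕ} {f : Fin n → ℕ} (hf : StrictMono f) (hne : ∃ i, f i ≠ i)
    (V : Finset (Fin n)) (hV : ∀ i, i ∈ V ↔ 0 < f i ∧ StrictMono (Function.update f i (f i - 1))) :
    G f = ∑ i ∈ V, G (Function.update f i (f i - 1)) := by
  have hle := le_of_strictMono hf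
  obtain ⟨m, hm⟩ : ∃ m, ∑ i, (f i - (i : ℕ)) = m + 1 := by
    apply Nat.exists_eq_succ_of_ne_zero
    intro h
    rw [Finset.sum_eq_zero_iff] at h
    obtain ⟨i, hi⟩ := hne
    have := h i (mem_univ _)
    have := hle i
    omega
  have hmq : (∑ i, (f i : ℚ) - ∑ i : Fin n, ((i : ℕ) : ℚ)) = m + 1 := by
    rw [← Finset.sum_sub_distrib]
    have : ((∑ i, (f i - (i : ℕ)) : ℕ) : ℚ) = ((m + 1 : ℕ) : ℚ) := by rw [hm]
    push_cast at this
    rw [← this]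
    apply Finset.sum_congr rfl
    intro i _
    rw [Nat.cast_sub (hle i)]
  have hk := key f
  rw [hmq] at hk
  have hprod : (∏ i, ((f i).factorial : ℚ)) ≠ 0 := by
    rw [Finset.prod_ne_zero_iff]
    intro i _
    exact_mod_cast Nat.factorial_ne_zero _
  have hterm : ∀ i ∈ V, G (Function.update f i (f i - 1)) =
      (m.factorial : ℚ) / (∏ i, ((f i).factorial : ℚ)) *
        ((f i : ℚ) * (DM (Function.update f i (f i - 1))).det) := by
    intro i hi
    obtain ⟨h0, hs⟩ := (hV i).1 hi
    have hle' := le_of_strictMono hs i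
    rw [Function.update_self] at hle'
    have s1 : ∑ k, (Function.update f i (f i - 1) k - (k : ℕ)) = m := by
      rw [← Finset.add_sum_erase _ _ (mem_univ i)] at hm ⊢
      rw [Function.update_self]
      have : ∑ k ∈ univ.erase i, (Function.update f i (f i - 1) k - (k : ℕ))
          = ∑ k ∈ univ.erase i, (f k - (k : ℕ)) := by
        apply Finset.sum_congr rfl
        intro k hk
        rw [Function.update_of_ne (Finset.mem_erase.1 hk).1]
      rw [this]
      omega
    have s2 : (∏ k, ((f k).factorial : ℚ)) =
        f i * ∏ k, ((Function.update f i (f i - 1) k).factorial : ℚ) := by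
      rw [← Finset.mul_prod_erase _ _ (mem_univ i),
        ← Finset.mul_prod_erase _ (fun k => ((Function.update f i (f i - 1) k).factorial : ℚ))
          (mem_univ i)]
      rw [Function.update_self, ← mul_assoc, ← Nat.mul_factorial_pred h0.ne']
      push_cast
      congr 1
      apply Finset.prod_congr rfl
      intro k hk
      rw [Function.update_of_ne (Finset.mem_erase.1 hk).1]
    have hfi : (f i : ℚ) ≠ 0 := by exact_mod_cast h0.ne'
    have hp2 : (∏ k, ((Function.update f i (f i - 1) k).factorial : ℚ)) ≠ 0 := by
      intro h; rw [h, mul_zero] at s2; exact hprod s2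
    unfold G
    rw [s1, s2]
    field_simp
  rw [Finset.sum_congr rfl hterm, ← Finset.mul_sum]
  have hsub : ∑ i ∈ V, (f i : ℚ) * (DM (Function.update f i (f i - 1))).det
      = ∑ i, (f i : ℚ) * (DM (Function.update f i (f i - 1))).det := by
    apply Finset.sum_subset (Finset.subset_univ _)
    intro i _ hi
    rcases Nat.eq_zero_or_pos (f i) with h0 | h0
    · simp [h0]
    · have hns : ¬ StrictMono (Function.update f i (f i - 1)) := fun h => hi ((hV i).2 ⟨h0, h⟩)
      have hmono : Monotone (Function.update f i (f i - 1)) := by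
        intro a b hab
        rcases hab.eq_or_lt with h | h
        · rw [h]
        · have := hf h
          by_cases ha : a = i
          · have hb : b ≠ i := by rintro rfl; exact absurd ha h.ne
            subst ha
            rw [Function.update_self, Function.update_of_ne hb]; omega
          · by_cases hb : b = i
            · subst hb
              rw [Function.update_self, Function.update_of_ne ha]; omega
            · rw [Function.update_of_ne ha, Function.update_of_ne hb]; omega
      have hninj : ¬ Function.Injective (Function.update f i (f i - 1)) :=
        fun h => hns (hmono.strictMono_of_injective h)
      simp only [Function.Injective, not_forall] at hninj
      obtain ⟨a, b, hab, hne⟩ := hninj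
      rw [Matrix.det_zero_of_row_eq hne, mul_zero]
      ext j
      simp only [DM, Matrix.of_apply, hab]
  rw [hsub, hk]
  unfold G
  rw [hm, Nat.factorial_succ]
  push_cast
  ring

theorem prod_Ioi_eq {n : ℕ} (F : ℕ → ℕ → ℚ) :
    ∏ i : Fin n, ∏ j ∈ Ioi i, F i j = ∏ j ∈ range n, ∏ i ∈ range j, F i j := by
  rw [Finset.prod_comm' (t' := univ) (s' := fun j => Iio j) (by simp)]
  rw [← Fin.prod_univ_eq_prod_range (fun j => ∏ i ∈ range j, F i j) n]
  apply Finset.prod_congr rfl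
  intro j _
  apply Finset.prod_bij (fun (i : Fin n) _ => (i : ℕ))
  · intro a ha; simpa using ha
  · intro a _ b _ h; exact Fin.ext h
  · intro b hb
    rw [Finset.mem_range] at hb
    exact ⟨⟨b, by omega⟩, by simpa [Fin.lt_def] using hb, rfl⟩
  · intros; rfl

theorem prod_sub (j : ℕ) : ∏ i ∈ range j, ((j : ℚ) - i) = j.factorial := by
  rw [← Finset.prod_range_reflect, ← Finset.prod_range_add_one_eq_factorial]
  push_cast
  apply Finset.prod_congr rfl
  intro i hi
  rw [Finset.mem_range] at hi
  rw [Nat.cast_sub (by omega), Nat.cast_sub (by omega)]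
  push_cast; ring

theorem G_top (n : ℕ) : G (fun i : Fin n => (i : ℕ)) = 1 := by
  unfold G
  rw [det_DM, prod_Ioi_eq (fun i j => (j : ℚ) - i),
    Fin.prod_univ_eq_prod_range (fun i => (i.factorial : ℚ)) n]
  simp only [prod_sub, Nat.sub_self, Finset.sum_const_zero, Nat.factorial_zero, Nat.cast_one]
  rw [one_div, inv_mul_cancel₀]
  rw [Finset.prod_ne_zero_iff]
  intro i _
  exact_mod_cast Nat.factorial_ne_zero _

theorem fact_two_mul (j : ℕ) : ((2 * j).factorial : ℚ) =
    2 ^ j * j.factorial * ∏ i ∈ Icc 1 j, ((2 * i - 1 : ℕ) : ℚ) := by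
  induction j with
  | zero => simp
  | succ k ih =>
    rw [Finset.prod_Icc_succ_top (by omega), show 2 * (k+1) = 2 * k + 1 + 1 by ring,
      Nat.factorial_succ, Nat.factorial_succ, Nat.factorial_succ]
    push_cast
    rw [ih]
    ring

theorem prod_dfact (n : ℕ) : ∏ i ∈ Icc 1 (n - 1), (2 * i - 1) ^ (n - i)
    = ∏ j ∈ range n, ∏ i ∈ Icc 1 j, (2 * i - 1) := by
  induction n with
  | zero => simp
  | succ k ih =>
    rw [Finset.prod_range_succ, ← ih, Nat.add_sub_cancel]
    have : ∏ i ∈ Icc 1 (k - 1), (2 * i - 1) ^ (k - i) = ∏ i ∈ Icc 1 k, (2 * i - 1) ^ (k - i) := by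
      apply Finset.prod_subset
      · intro i; simp; omega
      · intro i hi hi'
        simp only [Finset.mem_Icc] at hi hi'
        rw [show k - i = 0 by omega, pow_zero]
    rw [this, ← Finset.prod_mul_distrib]
    apply Finset.prod_congr rfl
    intro i hi
    rw [Finset.mem_Icc] at hi
    rw [← pow_succ]; congr 1; omega

theorem G_bot (n : ℕ) : G (fun i : Fin n => 2 * (i : ℕ)) *
    ((∏ i ∈ Icc 1 (n - 1), (2 * i - 1) ^ (n - i) : ℕ) : ℚ) = ((n.choose 2).factorial : ℚ) := by
  unfold G
  have hs : ∑ i : Fin n, (2 * (i : ℕ) - (i : ℕ)) = n.choose 2 := by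
    rw [Fin.sum_univ_eq_sum_range (fun i => 2 * i - i) n, Nat.choose_two_right,
      ← Finset.sum_range_id]
    apply Finset.sum_congr rfl
    intros; omega
  rw [det_DM, prod_dfact, hs, Fin.prod_univ_eq_prod_range (fun i => ((2 * i).factorial : ℚ)) n]
  have h1 : ∏ i : Fin n, ∏ j ∈ Ioi i, (((2 * (j : ℕ) : ℕ) : ℚ) - ((2 * (i : ℕ) : ℕ) : ℚ))
      = ∏ j ∈ range n, (2 ^ j * (j.factorial : ℚ)) := by
    rw [prod_Ioi_eq (fun i j => ((2 * (j : ℕ) : ℕ) : ℚ) - ((2 * (i : ℕ) : ℕ) : ℚ))]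
    apply Finset.prod_congr rfl
    intro j _
    rw [← prod_sub]
    have : (2 : ℚ) ^ j = ∏ i ∈ range j, 2 := by simp
    rw [this, ← Finset.prod_mul_distrib]
    apply Finset.prod_congr rfl
    intros; push_cast; ring
  rw [h1]
  have h2 : (∏ i ∈ range n, ((2 * i).factorial : ℚ)) ≠ 0 := by
    rw [Finset.prod_ne_zero_iff]
    intro i _
    exact_mod_cast Nat.factorial_ne_zero _
  push_cast
  rw [mul_assoc, ← Finset.prod_mul_distrib]
  have h3 : ∏ j ∈ range n, (2 ^ j * (j.factorial : ℚ) * ∏ i ∈ Icc 1 j, ((2 * i - 1 : ℕ) : ℚ))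
     = ∏ i ∈ range n, ((2 * i).factorial : ℚ) :=
    Finset.prod_congr rfl (fun j _ => (fact_two_mul j).symm)
  rw [h3, div_mul_cancel₀ _ h2]

end DyckAux

namespace DyckAux
open Finset

/-- position of north steps -/
noncomputable def q {n : ℕ} (d : DyckPath n) (i : Fin n) : ℕ :=
  Nat.nth (fun k => d.toList[k]? = some true) i

theorem count_take (L : List Bool) (k : ℕ) :
    (L.take k).count true = Nat.count (fun j => L[j]? = some true) k := by
  induction k with
  | zero => simp
  | succ k ih =>
    rw [List.take_add_one, List.count_append, ih, Nat.count_succ]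
    congr 1
    rcases h : L[k]? with _ | b
    · simp
    · cases b <;> simp

/-- number of north steps before time `k` -/
def c {n : ℕ} (d : DyckPath n) (k : ℕ) : ℕ := (d.toList.take k).count true

theorem c_le {n : ℕ} (d : DyckPath n) (k : ℕ) : c d k ≤ n := by
  conv_rhs => rw [← d.count_true]
  exact (List.take_sublist k d.toList).count_le true

theorem c_top {n : ℕ} (d : DyckPath n) : c d (2 * n) = n := by
  unfold c
  rw [← d.length_eq, List.take_length, d.count_true]

theorem lt_card {n : ℕ} (d : DyckPath n) (i : Fin n) :
    ∀ hf : (Set.ofPred (fun k : ℕ => d.toList[k]? = some true)).Finite, (i : ℕ) < #hf.toFinset := by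
  intro hf
  have := Nat.count_le_card hf (2 * n)
  rw [← count_take] at this
  have h2 := c_top d
  unfold c at h2
  have := i.2
  omega

theorem q_lt_iff {n : ℕ} (d : DyckPath n) (i : Fin n) (k : ℕ) : q d i < k ↔ (i : ℕ) < c d k := by
  unfold c q
  rw [count_take]
  constructor
  · intro h
    have h1 := Nat.count_nth_succ (lt_card d i)
    have h2 := Nat.count_monotone (fun k => d.toList[k]? = some true) (Nat.succ_le_of_lt h)
    simp only [Nat.succ_eq_add_one] at h2
    rw [h1] at h2
    omega
  · exact Nat.nth_lt_of_lt_count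

theorem c_q {n : ℕ} (d : DyckPath n) (i : Fin n) : c d (q d i) = i := by
  unfold c q
  rw [count_take]
  exact Nat.count_nth (lt_card d i)

theorem le_iff {n : ℕ} (a b : DyckPath n) : a ≤ b ↔ ∀ i, q b i ≤ q a i := by
  have : a ≤ b ↔ ∀ k, c a k ≤ c b k := Iff.rfl
  rw [this]
  constructor
  · intro h i
    have h1 := (q_lt_iff a i (q a i + 1)).1 (by omega)
    have := (q_lt_iff b i (q a i + 1)).2 (h1.trans_le (h _))
    omega
  · intro h k
    by_contra! hk
    have hn := c_le a k
    have h1 := (q_lt_iff a ⟨c b k, by omega⟩ k).2 hk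
    have h2 := (q_lt_iff b ⟨c b k, by omega⟩ k).1 ((h _).trans_lt h1)
    simp at h2

theorem q_inj {n : ℕ} {a b : DyckPath n} (h : q a = q b) : a = b :=
  le_antisymm ((le_iff a b).2 (fun i => by rw [h])) ((le_iff b a).2 (fun i => by rw [h]))

theorem q_strictMono {n : ℕ} (d : DyckPath n) : StrictMono (q d) := by
  intro i j hij
  by_contra! h
  have h1 := (q_lt_iff d j (q d i + 1)).1 (by omega)
  have h2 : c d (q d i + 1) = i + 1 := by
    unfold c q
    rw [count_take]
    exact Nat.count_nth_succ (lt_card d i)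
  have : (i : ℕ) < j := hij
  omega

theorem take_false {L : List Bool} {k : ℕ} (hk : k ≤ L.length) :
    (L.take k).count false + (L.take k).count true = k := by
  rw [List.count_false_add_count_true, List.length_take]; omega

theorem q_le {n : ℕ} (d : DyckPath n) (i : Fin n) : q d i ≤ 2 * i := by
  have h1 : q d i < 2 * n := (q_lt_iff d i _).2 (by rw [c_top]; exact i.2)
  have h2 : q d i ≤ d.toList.length := by rw [d.length_eq]; omega
  have h3 := d.diag _ h2
  have h4 := take_false h2
  have h5 := c_q d i
  unfold c at h5
  omega

theorem lt_card_filter {n : ℕ} {f : Fin n → ℕ} (hf : StrictMono f) (i : Fin n) (k : ℕ) :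
    (i : ℕ) < #(univ.filter (fun j => f j < k)) ↔ f i < k := by
  constructor
  · intro h
    by_contra! hk
    have : univ.filter (fun j => f j < k) ⊆ Iio i := by
      intro j hj
      simp only [mem_filter, mem_univ, true_and] at hj
      rw [mem_Iio]
      exact hf.lt_iff_lt.1 (hj.trans_le hk)
    have := card_le_card this
    rw [Fin.card_Iio] at this
    omega
  · intro h
    have : Iic i ⊆ univ.filter (fun j => f j < k) := by
      intro j hj
      simp only [mem_filter, mem_univ, true_and]
      exact (hf.monotone (mem_Iic.1 hj)).trans_lt h
    have := card_le_card this
    rw [Fin.card_Iic] at this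
    omega

open Classical in
theorem exists_path {n : ℕ} {f : Fin n → ℕ} (hf : StrictMono f) (hle : ∀ i, f i ≤ 2 * (i : ℕ)) :
    ∃ d : DyckPath n, q d = f := by
  let L : List Bool := (List.range (2 * n)).map (fun k => decide (∃ i, f i = k))
  have hL : ∀ k, L[k]? = some true ↔ ∃ i, f i = k := by
    intro k
    by_cases hk : k < 2 * n
    · simp [L, hk]
    · have : ¬ ∃ i, f i = k := by
        rintro ⟨i, hi⟩
        have := hle i
        have := i.2
        omega
      have h2 : L[k]? = none := List.getElem?_eq_none (by simp [L]; omega)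
      simp only [h2, this, reduceCtorEq]
  have hlen : L.length = 2 * n := by simp [L]
  have hc : ∀ k, (L.take k).count true = #(univ.filter (fun j => f j < k)) := by
    intro k
    rw [count_take, Nat.count_eq_card_filter_range, ← card_image_of_injective _ hf.injective]
    congr 1
    ext x
    simp only [mem_filter, mem_range, mem_image, mem_univ, true_and, hL]
    constructor
    · rintro ⟨h, i, rfl⟩; exact ⟨i, h, rfl⟩
    · rintro ⟨i, h, rfl⟩; exact ⟨h, i, rfl⟩
  have hct : L.count true = n := by
    have := hc (2 * n)
    rw [← hlen, List.take_length, hlen] at this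
    rw [this, filter_true_of_mem, card_univ, Fintype.card_fin]
    intro i _
    have := hle i
    have := i.2
    omega
  have hdiag : ∀ k ≤ L.length, (L.take k).count false ≤ (L.take k).count true := by
    intro k hk
    have h1 := take_false hk
    by_cases h : (L.take k).count true < n
    · have h2 := lt_card_filter hf ⟨_, h⟩ k
      rw [← hc k] at h2
      have h3 := hle ⟨_, h⟩
      simp only [lt_self_iff_false, false_iff, not_lt] at h2
      simp only at h3
      omega
    · omega
  refine ⟨⟨L, hlen, hct, hdiag⟩, ?_⟩
  funext i
  have key : ∀ k, q ⟨L, hlen, hct, hdiag⟩ i < k ↔ f i < k := by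
    intro k
    rw [q_lt_iff, ← lt_card_filter hf, ← hc k]
    rfl
  have h1 := (key (f i + 1)).2 (by omega)
  have h2 := (key (q ⟨L, hlen, hct, hdiag⟩ i + 1)).1 (by omega)
  omega

theorem finite_path (n : ℕ) : Finite (DyckPath n) := by
  have : Function.Injective (fun d : DyckPath n => fun i : Fin n =>
      (⟨q d i, by have := q_le d i; have := i.2; omega⟩ : Fin (2 * n))) := by
    intro a b h
    apply q_inj
    funext i
    exact congrArg Fin.val (congrFun h i)
  exact Finite.of_injective _ this

theorem covBy_of {n : ℕ} {d e : DyckPath n} (i : Fin n) (h0 : 0 < q d i)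
    (h : q e = Function.update (q d) i (q d i - 1)) : d ⋖ e := by
  have hi : q e i = q d i - 1 := by rw [h, Function.update_self]
  have hj : ∀ j, j ≠ i → q e j = q d j := fun j hj => by rw [h, Function.update_of_ne hj]
  have hde : d ≤ e := by
    rw [le_iff]
    intro j
    by_cases hji : j = i
    · subst hji; omega
    · rw [hj j hji]
  refine ⟨lt_of_le_of_ne hde ?_, ?_⟩
  · rintro rfl; omega
  · intro x hdx hxe
    have h1 := (le_iff _ _).1 hdx.le
    have h2 := (le_iff _ _).1 hxe.le
    by_cases hx : q x i = q d i
    · apply hdx.ne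
      apply q_inj
      funext j
      by_cases hji : j = i
      · rw [hji, hx]
      · have := h1 j; have := h2 j; have := hj j hji; omega
    · apply hxe.ne
      apply q_inj
      funext j
      by_cases hji : j = i
      · rw [hji]; have := h1 i; have := h2 i; omega
      · have := h1 j; have := h2 j; have := hj j hji; omega

theorem exists_of_covBy {n : ℕ} {d e : DyckPath n} (h : d ⋖ e) :
    ∃ i, (0 < q d i ∧ StrictMono (Function.update (q d) i (q d i - 1))) ∧
      q e = Function.update (q d) i (q d i - 1) := by
  have hle := (le_iff _ _).1 h.le
  have hex : (univ.filter (fun i => q e i < q d i)).Nonempty := by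
    by_contra hne
    rw [not_nonempty_iff_eq_empty, filter_eq_empty_iff] at hne
    apply h.lt.ne
    apply q_inj
    funext i
    have := hne (mem_univ i)
    have := hle i
    omega
  obtain ⟨i, hi⟩ := (univ.filter (fun i => q e i < q d i)).exists_minimal hex
  have hi1 : q e i < q d i := by simpa using hi.prop
  have hlt : ∀ j, j < i → q e j = q d j := by
    intro j hj
    have := hle j
    by_contra hne
    exact absurd (hi.le_of_le (by simp; omega) hj.le) (not_le_of_gt hj)
  have hs : StrictMono (Function.update (q d) i (q d i - 1)) := by
    intro a b hab
    have h1 := q_strictMono d hab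
    have h2 := q_strictMono e hab
    by_cases ha : a = i
    · have hb : b ≠ i := by rintro rfl; exact absurd ha hab.ne
      subst ha
      rw [Function.update_self, Function.update_of_ne hb]; omega
    · by_cases hb : b = i
      · subst hb
        rw [Function.update_self, Function.update_of_ne ha]
        have := hlt a hab
        omega
      · rw [Function.update_of_ne ha, Function.update_of_ne hb]; omega
  obtain ⟨x, hx⟩ := exists_path hs (by
    intro j
    have := q_le d j
    by_cases hji : j = i
    · subst hji; rw [Function.update_self]; omega
    · rw [Function.update_of_ne hji]; exact this)
  have h0 : 0 < q d i := by omega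
  have hdx := covBy_of i h0 hx
  have hxe : x ≤ e := by
    rw [le_iff, hx]
    intro j
    by_cases hji : j = i
    · subst hji; rw [Function.update_self]; omega
    · rw [Function.update_of_ne hji]; exact hle j
  refine ⟨i, ⟨h0, hs⟩, ?_⟩
  rcases h.eq_or_eq hdx.le hxe with h' | h'
  · exact absurd h' hdx.lt.ne'
  · rw [← h', hx]

end DyckAux

namespace DyckAux
theorem g_rec {n : ℕ} {t d : DyckPath n} (hqt : q t = fun i : Fin n => (i : ℕ)) (hd : d ≠ t)
    (S : Finset (DyckPath n)) (hS : ∀ e, e ∈ S ↔ d ⋖ e) : G (q d) = ∑ e ∈ S, G (q e) := by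
  classical
  have hne : ∃ i, q d i ≠ i := by
    by_contra! h
    exact hd (q_inj (by rw [hqt]; funext i; exact h i))
  rw [G_eq (q_strictMono d) hne (Finset.univ.filter (fun i => 0 < q d i ∧
    StrictMono (Function.update (q d) i (q d i - 1)))) (by simp)]
  symm
  have hex : ∀ e ∈ S, ∃ i, (0 < q d i ∧ StrictMono (Function.update (q d) i (q d i - 1))) ∧
      q e = Function.update (q d) i (q d i - 1) := fun e he => exists_of_covBy ((hS e).1 he)
  choose φ h1 h2 using hex
  apply Finset.sum_bij φ
  · intro e he
    simpa using h1 e he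
  · intro a ha b hb hab
    apply q_inj
    rw [h2 a ha, h2 b hb, hab]
  · intro i hi
    simp only [Finset.mem_filter, Finset.mem_univ, true_and] at hi
    obtain ⟨e, he⟩ := exists_path hi.2 (by
      intro j
      have := q_le d j
      by_cases hji : j = i
      · subst hji; rw [Function.update_self]; omega
      · rw [Function.update_of_ne hji]; exact this)
    have heS : e ∈ S := (hS e).2 (covBy_of i hi.1 he)
    refine ⟨e, heS, ?_⟩
    by_contra hne
    have h3 := h2 e heS
    rw [he] at h3
    have h4 := congrFun h3 i
    rw [Function.update_self, Function.update_of_ne (Ne.symm hne)] at h4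
    have := hi.1
    omega
  · intro e he
    rw [h2 e he]

end DyckAux

/-- The number of maximal chains in the poset of Dyck paths of order `n`
ordered by inclusion equals
`(binomial n 2)! / ∏_{i=1}^{n-1} (2i - 1)^(n - i)`. -/
theorem card_maximal_chains_dyckPath (n : ℕ) :
    Nat.card {s : Set (DyckPath n) // IsMaxChain (· ≤ ·) s} =
      (n.choose 2).factorial / ∏ i ∈ Finset.Icc 1 (n - 1), (2 * i - 1) ^ (n - i) := by
  have := DyckAux.finite_path n
  obtain ⟨t, ht⟩ := DyckAux.exists_path (n := n) (f := fun i => (i : ℕ)) (fun a b h => h)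
    (fun i => by omega)
  obtain ⟨b, hb⟩ := DyckAux.exists_path (n := n) (f := fun i => 2 * (i : ℕ))
    (fun a b h => by have : (a : ℕ) < b := h; simp only; omega) (fun i => le_rfl)
  have h1 := DyckAux.card_maxChain (P := DyckPath n) (t := t) (b := b)
    (fun x => (DyckAux.le_iff _ _).2 (fun i => by
      rw [ht]; exact DyckAux.le_of_strictMono (DyckAux.q_strictMono x) i))
    (fun x => (DyckAux.le_iff _ _).2 (fun i => by rw [hb]; exact DyckAux.q_le x i))
    (fun d => DyckAux.G (DyckAux.q d)) (by simp only [ht]; exact DyckAux.G_top n)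
    (fun d hd S hS => DyckAux.g_rec ht hd S hS)
  have h2 := DyckAux.G_bot n
  simp only [hb] at h1
  rw [← h1] at h2
  have h3 : Nat.card {s : Set (DyckPath n) // IsMaxChain (· ≤ ·) s} *
      ∏ i ∈ Finset.Icc 1 (n - 1), (2 * i - 1) ^ (n - i) = (n.choose 2).factorial := by
    exact_mod_cast h2
  rw [← h3, Nat.mul_div_cancel]
  apply Finset.prod_pos
  intro i hi
  rw [Finset.mem_Icc] at hi
  exact Nat.pow_pos (by omega)
end

section
/- The number of maximal chains in the poset of Dyck paths of order n ordered by inclusion equals the number of standard Young tableaux of the staircase shape (n-1, n-2, …, 2, 1). -/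
/-- A standard Young tableau of the staircase shape `(n-1, n-2, …, 2, 1)`:
a bijective filling of the `binomial n 2` cells `(i, j)` (row `i`, column `j`,
with `i + j + 2 ≤ n`) by the numbers `0, 1, …, binomial n 2 - 1` (equivalently
`1, …, binomial n 2`), strictly increasing along each row and down each
column. -/
def StaircaseSYT (n : ℕ) : Type :=
  {f : {p : ℕ × ℕ // p.1 + p.2 + 2 ≤ n} → Fin (n.choose 2) //
    Function.Bijective f ∧
    (∀ p q : {p : ℕ × ℕ // p.1 + p.2 + 2 ≤ n}, p.1.1 = q.1.1 → p.1.2 < q.1.2 → f p < f q) ∧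
    (∀ p q : {p : ℕ × ℕ // p.1 + p.2 + 2 ≤ n}, p.1.2 = q.1.2 → p.1.1 < q.1.1 → f p < f q)}

section General

variable {P : Type*} [PartialOrder P]

theorem mem_of_isMaxChain {C : Set (LowerSet P)} (hC : IsMaxChain (· ≤ ·) C) {X : LowerSet P}
    (h : ∀ J ∈ C, X ≤ J ∨ J ≤ X) : X ∈ C := by
  have h2 := hC.2 (hC.1.insert (a := X) (fun J hJ _ => h J hJ)) (Set.subset_insert X C)
  rw [h2]; exact Set.mem_insert X C

/-- smallest member of the chain containing `p` -/
def minI (C : Set (LowerSet P)) (p : P) : LowerSet P := sInf {J | J ∈ C ∧ p ∈ J}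

theorem mem_minI (C : Set (LowerSet P)) (p : P) : p ∈ minI C p := by
  unfold minI
  rw [LowerSet.mem_sInf_iff]
  exact fun J hJ => hJ.2

theorem minI_le {C : Set (LowerSet P)} {p : P} {J : LowerSet P} (hJ : J ∈ C) (hp : p ∈ J) :
    minI C p ≤ J := sInf_le ⟨hJ, hp⟩

theorem chain_le {C : Set (LowerSet P)} (hC : IsMaxChain (· ≤ ·) C) {p : P} {J K : LowerSet P}
    (hJ : J ∈ C) (hK : K ∈ C) (hp : p ∉ J) (hp' : p ∈ K) : J ≤ K := by
  rcases hC.1.total hJ hK with h | h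
  · exact h
  · exact absurd (h hp') hp

theorem minI_mem {C : Set (LowerSet P)} (hC : IsMaxChain (· ≤ ·) C) (p : P) : minI C p ∈ C := by
  apply mem_of_isMaxChain hC
  intro J hJ
  by_cases hp : p ∈ J
  · exact Or.inl (minI_le hJ hp)
  · exact Or.inr (le_sInf fun K hK => chain_le hC hJ hK.1 hp hK.2)

theorem minI_ne {C : Set (LowerSet P)} (hC : IsMaxChain (· ≤ ·) C) {p q : P} (hqp : ¬ q ≤ p) :
    minI C p ≠ minI C q := by
  intro heq
  set K : LowerSet P := sSup {J | J ∈ C ∧ p ∉ J} with hK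
  have hqK : q ∉ K := by
    rw [hK, LowerSet.mem_sSup_iff]
    rintro ⟨J, ⟨hJ, hp⟩, hq⟩
    have := minI_le hJ hq
    rw [← heq] at this
    exact hp (this (mem_minI C p))
  have hmem : K ⊔ LowerSet.Iic p ∈ C := by
    apply mem_of_isMaxChain hC
    intro J hJ
    by_cases hp : p ∈ J
    · left
      apply sup_le
      · exact sSup_le fun L hL => chain_le hC hL.1 hJ hL.2 hp
      · exact LowerSet.Iic_le.2 hp
    · right
      exact le_trans (le_sSup (show J ∈ {J | J ∈ C ∧ p ∉ J} from ⟨hJ, hp⟩)) le_sup_left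
  have h1 : minI C p ≤ K ⊔ LowerSet.Iic p :=
    minI_le hmem (LowerSet.mem_sup_iff.2 (Or.inr (LowerSet.mem_Iic_iff.2 le_rfl)))
  have h2 : q ∈ K ⊔ LowerSet.Iic p := h1 (heq ▸ mem_minI C q)
  rcases LowerSet.mem_sup_iff.1 h2 with h | h
  · exact hqK h
  · exact hqp (LowerSet.mem_Iic_iff.1 h)

theorem minI_injective {C : Set (LowerSet P)} (hC : IsMaxChain (· ≤ ·) C) :
    Function.Injective (minI C) := by
  intro p q h
  by_contra hne
  by_cases hqp : q ≤ p
  · have : ¬ p ≤ q := fun h' => hne (le_antisymm h' hqp)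
    exact minI_ne hC this h.symm
  · exact minI_ne hC hqp h

theorem ncard_le_iff [Finite P] {C : Set (LowerSet P)} (hC : IsChain (· ≤ ·) C)
    {J K : LowerSet P} (hJ : J ∈ C) (hK : K ∈ C) :
    (J : Set P).ncard ≤ (K : Set P).ncard ↔ J ≤ K := by
  constructor
  · intro h
    rcases hC.total hJ hK with h' | h'
    · exact h'
    · have := Set.eq_of_subset_of_ncard_le (LowerSet.coe_subset_coe.2 h') h (Set.toFinite _)
      exact (SetLike.coe_injective this).ge
  · intro h
    exact Set.ncard_le_ncard (LowerSet.coe_subset_coe.2 h) (Set.toFinite _)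

/-- initial segments -/
def seg {N : ℕ} (f : P → Fin N) (hf : StrictMono f) (k : ℕ) : LowerSet P where
  carrier := {p | (f p : ℕ) < k}
  lower' := by
    intro a b hab ha
    have : f b ≤ f a := hf.monotone hab
    simp only [Set.mem_setOf_eq] at *
    omega

theorem mem_seg {N : ℕ} (f : P → Fin N) (hf : StrictMono f) (k : ℕ) (p : P) :
    p ∈ seg f hf k ↔ (f p : ℕ) < k := Iff.rfl

theorem ncard_seg {N : ℕ} (f : P → Fin N) (hf : StrictMono f) (hb : Function.Bijective f) (k : ℕ)
    (hk : k ≤ N) : (seg f hf k : Set P).ncard = k := by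
  have h1 : (seg f hf k : Set P) = f ⁻¹' {x | (x : ℕ) < k} := rfl
  rw [h1, Set.ncard_preimage_of_injective_subset_range hb.1 (by rw [hb.2.range_eq]; exact Set.subset_univ _)]
  have h2 : {x : Fin N | (x : ℕ) < k} = Set.range (Fin.castLE hk) := by
    rw [Fin.range_castLE]
  rw [h2, ← Set.image_univ, Set.ncard_image_of_injective _ (Fin.castLE_injective hk), Set.ncard_univ]
  simp

theorem seg_isMaxChain [Finite P] {N : ℕ} (hN : Nat.card P = N) (f : P → Fin N)
    (hf : StrictMono f) (hb : Function.Bijective f) :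
    IsMaxChain (· ≤ ·) {I | ∃ k ≤ N, I = seg f hf k} := by
  constructor
  · rintro _ ⟨k, hk, rfl⟩ _ ⟨l, hl, rfl⟩ _
    rcases le_total k l with h | h
    · left; intro p hp; exact lt_of_lt_of_le hp h
    · right; intro p hp; exact lt_of_lt_of_le hp h
  · intro D hD hsub
    apply Set.Subset.antisymm hsub
    intro J hJ
    have hc : (J : Set P).ncard ≤ N := hN ▸ Set.ncard_le_card _
    refine ⟨_, hc, ?_⟩
    have hm : seg f hf (J : Set P).ncard ∈ D := hsub ⟨_, hc, rfl⟩
    have he := ncard_seg f hf hb _ hc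
    exact le_antisymm ((ncard_le_iff hD hJ hm).1 he.ge) ((ncard_le_iff hD hm hJ).1 he.le)

theorem card_general [Finite P] {N : ℕ} (hN : Nat.card P = N) :
    Nat.card {f : P → Fin N // Function.Bijective f ∧ StrictMono f} =
    Nat.card {C : Set (LowerSet P) // IsMaxChain (· ≤ ·) C} := by
  apply Nat.card_eq_of_bijective
    (fun f => (⟨_, seg_isMaxChain hN f.1 f.2.2 f.2.1⟩ :
      {C : Set (LowerSet P) // IsMaxChain (· ≤ ·) C}))
  constructor
  · rintro ⟨f, hb, hf⟩ ⟨g, hb', hg⟩ h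
    simp only [Subtype.mk.injEq] at h
    have key : ∀ k ≤ N, seg f hf k = seg g hg k := by
      intro k hk
      have h1 : seg f hf k ∈ {I | ∃ k ≤ N, I = seg g hg k} := h ▸ ⟨k, hk, rfl⟩
      obtain ⟨l, hl, e⟩ := h1
      have h2 := ncard_seg f hf hb k hk
      rw [e, ncard_seg g hg hb' l hl] at h2
      rw [e, h2]
    apply Subtype.ext
    funext p
    apply Fin.ext
    have a1 : p ∈ seg g hg (f p + 1) := by
      rw [← key _ (f p).2, mem_seg]; omega
    have a2 : p ∈ seg f hf (g p + 1) := by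
      rw [key _ (g p).2, mem_seg]; omega
    rw [mem_seg] at a1 a2
    show (f p : ℕ) = g p
    omega
  · rintro ⟨C, hC⟩
    have hpos : ∀ p, 0 < (minI C p : Set P).ncard := fun p =>
      (Set.ncard_pos (Set.toFinite _)).2 ⟨p, mem_minI C p⟩
    have hle : ∀ p, (minI C p : Set P).ncard ≤ N := fun p => hN ▸ Set.ncard_le_card _
    let f : P → Fin N := fun p => ⟨(minI C p : Set P).ncard - 1, by
      have := hpos p; have := hle p; omega⟩
    have hfv : ∀ p, (f p : ℕ) + 1 = (minI C p : Set P).ncard := fun p => by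
      have := hpos p; simp only [f]; omega
    have hinj : Function.Injective f := by
      intro p q h
      have h1 := hfv p
      rw [h, hfv q] at h1
      apply minI_injective hC
      exact le_antisymm ((ncard_le_iff hC.1 (minI_mem hC p) (minI_mem hC q)).1 h1.ge)
        ((ncard_le_iff hC.1 (minI_mem hC q) (minI_mem hC p)).1 h1.le)
    have hbij : Function.Bijective f := by
      apply hinj.bijective_of_nat_card_le
      simp [hN]
    have hmono : StrictMono f := by
      apply Monotone.strictMono_of_injective _ hinj
      intro p q hpq
      have : minI C p ≤ minI C q :=
        minI_le (minI_mem hC q) ((minI C q).lower hpq (mem_minI C q))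
      have := (ncard_le_iff hC.1 (minI_mem hC p) (minI_mem hC q)).2 this
      have h1 := hfv p
      have h2 := hfv q
      rw [Fin.le_def]
      omega
    refine ⟨⟨f, hbij, hmono⟩, ?_⟩
    apply Subtype.ext
    symm
    apply hC.2 (seg_isMaxChain hN f hmono hbij).1
    intro J hJ
    refine ⟨(J : Set P).ncard, hN ▸ Set.ncard_le_card _, ?_⟩
    ext p
    show p ∈ J ↔ p ∈ seg f hmono _
    rw [mem_seg, ← Nat.succ_le_iff, Nat.succ_eq_add_one, hfv,
      ncard_le_iff hC.1 (minI_mem hC p) hJ]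
    exact ⟨fun h => minI_le hJ h, fun h => h (mem_minI C p)⟩

end General

abbrev Cell (n : ℕ) : Type := {p : ℕ × ℕ // p.1 + p.2 + 2 ≤ n}

theorem cell_finite (n : ℕ) : Finite (Cell n) := by
  apply Set.Finite.subset (s := (↑(Finset.range n ×ˢ Finset.range n) : Set (ℕ × ℕ)))
    (Finset.finite_toSet _)
  rintro ⟨a, b⟩ h
  have h' : a + b + 2 ≤ n := h
  simp only [Finset.coe_product, Finset.coe_range, Set.mem_prod, Set.mem_Iio]
  omega

theorem card_cell (n : ℕ) : Nat.card (Cell n) = n.choose 2 := by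
  have h1 : Nat.card (Cell n) =
      ((Finset.range n).sigma (fun i => Finset.range (n - 1 - i))).card := by
    rw [← Nat.card_eq_finsetCard]
    apply Nat.card_congr
    exact
    { toFun := fun p => ⟨⟨p.1.1, p.1.2⟩, by
        have := p.2
        simp only [Finset.mem_sigma, Finset.mem_range]; omega⟩
      invFun := fun s => ⟨(s.1.1, s.1.2), by
        have := s.2
        simp only [Finset.mem_sigma, Finset.mem_range] at this
        show s.1.1 + s.1.2 + 2 ≤ n
        omega⟩
      left_inv := fun p => rfl
      right_inv := fun s => rfl }
  rw [h1, Finset.card_sigma]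
  simp only [Finset.card_range]
  rw [Finset.sum_range_reflect (fun i => i) n, Finset.sum_range_id, Nat.choose_two_right]

/-- height function -/
def ht {n : ℕ} (d : DyckPath n) (k : ℕ) : ℕ := (d.toList.take k).count true

theorem ht_step {n : ℕ} (d : DyckPath n) (k : ℕ) :
    ht d k ≤ ht d (k + 1) ∧ ht d (k + 1) ≤ ht d k + 1 := by
  unfold ht
  rw [List.take_succ, List.count_append]
  have : (d.toList[k]?.toList).count true ≤ 1 := by
    refine le_trans List.count_le_length ?_
    cases d.toList[k]? <;> simp
  omega

theorem ht_mono {n : ℕ} (d : DyckPath n) : Monotone (ht d) :=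
  monotone_nat_of_le_succ fun k => (ht_step d k).1

theorem ht_add {n : ℕ} (d : DyckPath n) (k m : ℕ) : ht d (k + m) ≤ ht d k + m := by
  induction m with
  | zero => simp
  | succ m ih => have := (ht_step d (k + m)).2; rw [← add_assoc]; omega

theorem ht_diag {n : ℕ} (d : DyckPath n) (k : ℕ) (hk : k ≤ 2 * n) : k ≤ 2 * ht d k := by
  have h1 := d.diag k (by rw [d.length_eq]; exact hk)
  have h2 := List.count_false_add_count_true (d.toList.take k)
  rw [List.length_take, d.length_eq, min_eq_left hk] at h2
  unfold ht
  omega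

theorem ht_big {n : ℕ} (d : DyckPath n) (k : ℕ) (hk : 2 * n ≤ k) : ht d k = n := by
  unfold ht
  rw [List.take_of_length_le (by rw [d.length_eq]; exact hk), d.count_true]

theorem ht_le {n : ℕ} (d : DyckPath n) (k : ℕ) : ht d k ≤ n := by
  calc ht d k ≤ ht d (k + 2 * n) := ht_mono d (by omega)
    _ = n := ht_big d _ (by omega)

theorem ht_le_self {n : ℕ} (d : DyckPath n) (k : ℕ) : ht d k ≤ k := by
  have := ht_add d 0 k
  have h0 : ht d 0 = 0 := by simp [ht]
  rw [h0] at this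
  simpa using this

/-- cells above the path -/
def above {n : ℕ} (d : DyckPath n) : LowerSet (Cell n) where
  carrier := {p | ht d (n - p.1.1 + p.1.2) < n - p.1.1}
  lower' := by
    rintro ⟨⟨a, b⟩, h⟩ ⟨⟨a', b'⟩, h'⟩ hab hm
    have hab' : a' ≤ a ∧ b' ≤ b := hab
    simp only [Set.mem_setOf_eq] at *
    have h1 : ht d (n - a + b') ≤ ht d (n - a + b) := ht_mono d (by omega)
    have h2 := ht_add d (n - a + b') (a - a')
    have h3 : n - a + b' + (a - a') = n - a' + b' := by omega
    rw [h3] at h2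
    omega

theorem mem_above {n : ℕ} (d : DyckPath n) (p : Cell n) :
    p ∈ above d ↔ ht d (n - p.1.1 + p.1.2) < n - p.1.1 := Iff.rfl

theorem above_le_iff {n : ℕ} (d e : DyckPath n) : above e ≤ above d ↔ d ≤ e := by
  constructor
  · intro h k
    show ht d k ≤ ht e k
    by_contra! hlt
    have hk : k < 2 * n := by
      by_contra! hk
      rw [ht_big d k hk, ht_big e k hk] at hlt
      omega
    have h1 := ht_diag e k hk.le
    have h2 := ht_le d k
    have h3 := ht_le_self d k
    have e1 : n - (n - ht d k) = ht d k := by omega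
    have e2 : ht d k + (k - ht d k) = k := by omega
    let c : Cell n := ⟨(n - ht d k, k - ht d k), by
      show n - ht d k + (k - ht d k) + 2 ≤ n
      omega⟩
    have hc : c ∈ above e := by
      rw [mem_above]
      show ht e (n - (n - ht d k) + (k - ht d k)) < n - (n - ht d k)
      rw [e1, e2]; exact hlt
    have hc' : ht d (n - (n - ht d k) + (k - ht d k)) < n - (n - ht d k) := h hc
    rw [e1, e2] at hc'
    omega
  · intro h p hp
    have h' : ht d (n - p.1.1 + p.1.2) ≤ ht e (n - p.1.1 + p.1.2) := h _
    exact lt_of_le_of_lt h' hp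

theorem exists_path {n : ℕ} (h : ℕ → ℕ) (h0 : h 0 = 0)
    (h1 : ∀ k, h k ≤ h (k + 1)) (h2 : ∀ k, h (k + 1) ≤ h k + 1) (hn : ∀ k, h k ≤ n)
    (hd : ∀ k ≤ 2 * n, k ≤ 2 * h k) : ∃ d : DyckPath n, ∀ k ≤ 2 * n, ht d k = h k := by
  set l : List Bool := (List.range (2 * n)).map (fun k => decide (h (k + 1) = h k + 1)) with hl
  have hlen : l.length = 2 * n := by simp [hl]
  have hcount : ∀ k ≤ 2 * n, (l.take k).count true = h k := by
    intro k
    induction k with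
    | zero => simp [h0]
    | succ k ih =>
      intro hk
      rw [List.take_succ, List.count_append, ih (by omega)]
      have hg : l[k]? = some (decide (h (k + 1) = h k + 1)) := by
        simp [hl, List.getElem?_range (show k < 2 * n by omega)]
      rw [hg]
      have := h1 k
      have := h2 k
      by_cases hh : h (k + 1) = h k + 1
      · simp [hh]
      · simp [hh]; omega
  refine ⟨⟨l, hlen, ?_, ?_⟩, hcount⟩
  · have := hcount (2 * n) le_rfl
    rw [List.take_of_length_le hlen.le] at this
    rw [this]
    have := hd (2 * n) le_rfl
    have := hn (2 * n)
    omega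
  · intro k hk
    rw [hlen] at hk
    have e2 := List.count_false_add_count_true (l.take k)
    rw [List.length_take, hlen, min_eq_left hk, hcount k hk] at e2
    have := hd k hk
    rw [hcount k hk]
    omega

theorem above_surj {n : ℕ} (L : LowerSet (Cell n)) : ∃ d : DyckPath n, above d = L := by
  classical
  let T : ℕ → ℕ → Prop := fun a b => ∃ hab : a + b + 2 ≤ n, (⟨(a, b), hab⟩ : Cell n) ∈ L
  have hT : ∀ a b a' b', a' ≤ a → b' ≤ b → T a b → T a' b' := by
    rintro a b a' b' ha hb ⟨hab, hm⟩
    exact ⟨by omega, L.lower (show (⟨(a', b'), by omega⟩ : Cell n) ≤ ⟨(a, b), hab⟩ from ⟨ha, hb⟩) hm⟩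
  let S : ℕ → ℕ → Prop := fun k y => y ≤ k ∧ ¬ T (n - y) (k - y)
  let h : ℕ → ℕ := fun k => Nat.findGreatest (S k) n
  have hn : ∀ k, h k ≤ n := fun k => Nat.findGreatest_le n
  have hS0 : ∀ k, S k 0 := fun k => ⟨Nat.zero_le _, by rintro ⟨hh, -⟩; omega⟩
  have hS : ∀ k, S k (h k) := fun k => Nat.findGreatest_spec (Nat.zero_le n) (hS0 k)
  have hle : ∀ k y, y ≤ n → S k y → y ≤ h k := fun k y hy hs => Nat.le_findGreatest hy hs
  have hdown : ∀ k y y', y' ≤ y → S k y → S k y' := by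
    rintro k y y' hy ⟨h1, h2⟩
    exact ⟨by omega, fun ht => h2 (hT _ _ _ _ (by omega) (by omega) ht)⟩
  obtain ⟨d, hd⟩ := exists_path (n := n) h (Nat.le_zero.1 (hS 0).1)
    (fun k => hle _ _ (hn k) ⟨by have := (hS k).1; omega,
      fun ht => (hS k).2 (hT _ _ _ _ le_rfl (by omega) ht)⟩)
    (fun k => by
      by_contra! hlt
      have hs := hS (k + 1)
      have hnk := hn (k + 1)
      have : h (k + 1) - 1 ≤ h k := by
        apply hle _ _ (by omega)
        refine ⟨by have := hs.1; omega, fun ht => hs.2 (hT _ _ _ _ (by omega) (by omega) ht)⟩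
      omega)
    hn
    (fun k hk => by
      have : (k + 1) / 2 ≤ h k := by
        apply hle _ _ (by omega)
        refine ⟨by omega, ?_⟩
        rintro ⟨hh, -⟩
        omega
      omega)
  refine ⟨d, ?_⟩
  ext p
  obtain ⟨⟨i, j⟩, hp⟩ := p
  have hp' : i + j + 2 ≤ n := hp
  show ht d (n - i + j) < n - i ↔ (⟨(i, j), hp⟩ : Cell n) ∈ L
  rw [hd _ (by omega)]
  have e1 : n - (n - i) = i := by omega
  have e2 : n - i + j - (n - i) = j := by omega
  have hiff : S (n - i + j) (n - i) ↔ ¬ T i j := by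
    show (n - i ≤ n - i + j ∧ ¬ T (n - (n - i)) (n - i + j - (n - i))) ↔ _
    rw [e1, e2]
    simp
  have hTiff : T i j ↔ (⟨(i, j), hp⟩ : Cell n) ∈ L := ⟨fun ⟨_, hm⟩ => hm, fun hm => ⟨hp, hm⟩⟩
  rw [← hTiff]
  constructor
  · intro hlt
    by_contra hnT
    have := hle _ _ (by omega) (hiff.2 hnT)
    omega
  · intro ht
    by_contra! hge
    exact hiff.1 (hdown _ _ _ hge (hS _)) ht

noncomputable def pathIso (n : ℕ) :
    RelIso (fun a b : DyckPath n => a ≤ b) (fun a b : LowerSet (Cell n) => b ≤ a) where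
  toEquiv := Equiv.ofBijective above ⟨fun d e h =>
    le_antisymm ((above_le_iff d e).1 h.ge) ((above_le_iff e d).1 h.le), above_surj⟩
  map_rel_iff' := by
    intro a b
    exact above_le_iff a b

theorem card_chains (n : ℕ) : Nat.card {s : Set (DyckPath n) // IsMaxChain (· ≤ ·) s} =
    Nat.card {C : Set (LowerSet (Cell n)) // IsMaxChain (· ≤ ·) C} := by
  apply Nat.card_congr
  refine Equiv.subtypeEquiv (Equiv.Set.congr (pathIso n).toEquiv) ?_
  intro s
  have key : IsMaxChain (fun a b : LowerSet (Cell n) => b ≤ a) (pathIso n '' s) ↔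
      IsMaxChain (· ≤ ·) (pathIso n '' s) := ⟨fun h => h.symm, fun h => h.symm⟩
  show _ ↔ IsMaxChain (· ≤ ·) (pathIso n '' s)
  rw [← key]
  constructor
  · intro h
    exact h.image (pathIso n)
  · intro h
    have h2 := h.image (pathIso n).symm
    rw [← Set.image_comp] at h2
    simpa using h2

theorem card_SYT (n : ℕ) : Nat.card (StaircaseSYT n) =
    Nat.card {f : Cell n → Fin (n.choose 2) // Function.Bijective f ∧ StrictMono f} := by
  apply Nat.card_congr
  refine Equiv.subtypeEquivRight ?_
  intro f
  refine and_congr_right fun hb => ?_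
  constructor
  · rintro ⟨hr, hc⟩
    refine Monotone.strictMono_of_injective ?_ hb.1
    rintro ⟨⟨a, b⟩, h⟩ ⟨⟨a', b'⟩, h'⟩ hab
    have hab' : a ≤ a' ∧ b ≤ b' := hab
    have hh : a' + b' + 2 ≤ n := h'
    have hm : a + b' + 2 ≤ n := by omega
    have s1 : f ⟨(a, b), h⟩ ≤ f ⟨(a, b'), hm⟩ := by
      rcases hab'.2.eq_or_lt with e | e
      · subst e; exact le_rfl
      · exact (hr ⟨(a, b), h⟩ ⟨(a, b'), hm⟩ rfl e).le
    have s2 : f ⟨(a, b'), hm⟩ ≤ f ⟨(a', b'), h'⟩ := by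
      rcases hab'.1.eq_or_lt with e | e
      · subst e; exact le_rfl
      · exact (hc ⟨(a, b'), hm⟩ ⟨(a', b'), h'⟩ rfl e).le
    exact s1.trans s2
  · intro hf
    constructor
    · intro p q h1 h2
      apply hf
      apply lt_of_le_of_ne (show p.1.1 ≤ q.1.1 ∧ p.1.2 ≤ q.1.2 from ⟨h1.le, h2.le⟩)
      rintro rfl
      exact lt_irrefl _ h2
    · intro p q h1 h2
      apply hf
      apply lt_of_le_of_ne (show p.1.1 ≤ q.1.1 ∧ p.1.2 ≤ q.1.2 from ⟨h2.le, h1.le⟩)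
      rintro rfl
      exact lt_irrefl _ h2

/-- The number of maximal chains in the poset of Dyck paths of order `n`
ordered by inclusion equals the number of standard Young tableaux of the
staircase shape `(n-1, n-2, …, 2, 1)`. -/
theorem card_maximal_chains_eq_card_SYT (n : ℕ) :
    Nat.card {s : Set (DyckPath n) // IsMaxChain (· ≤ ·) s} =
      Nat.card (StaircaseSYT n) := by
  have := cell_finite n
  rw [card_chains, card_SYT, card_general (card_cell n)]
end

section
/- (Dilworth's theorem) For any finite poset P, the maximum size of an antichain in P equals the minimum number of chains into which P can be partitioned. -/
theorem dil_inj {P : Type*} [PartialOrder P] (S : Finset P) (f : P → ℕ)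
    (hf : ∀ x ∈ S, ∀ y ∈ S, f x = f y → x ≤ y ∨ y ≤ x) (B : Finset P) (hB : B ⊆ S)
    (hA : IsAntichain (· ≤ ·) (B : Set P)) : Set.InjOn f (B : Set P) := by
  intro x hx y hy h
  rcases hf x (hB hx) y (hB hy) h with h | h
  · exact hA.eq hx hy h
  · exact (hA.eq hy hx h).symm

theorem dil_hit {P : Type*} [PartialOrder P] (S : Finset P) (f : P → ℕ) (k : ℕ)
    (hk : ∀ x ∈ S, f x < k)
    (hf : ∀ x ∈ S, ∀ y ∈ S, f x = f y → x ≤ y ∨ y ≤ x) (B : Finset P) (hB : B ⊆ S)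
    (hA : IsAntichain (· ≤ ·) (B : Set P)) (hc : k ≤ B.card) (i : ℕ) (hi : i < k) :
    ∃ y ∈ B, f y = i := by
  classical
  have h1 : B.image f = Finset.range k := by
    apply Finset.eq_of_subset_of_card_le
    · intro j hj
      obtain ⟨x, hx, rfl⟩ := Finset.mem_image.1 hj
      exact Finset.mem_range.2 (hk x (hB hx))
    · rw [Finset.card_image_of_injOn (dil_inj S f hf B hB hA)]
      simpa using hc
  have : i ∈ B.image f := by rw [h1]; simpa using hi
  simpa using this

theorem dil_main {P : Type*} [PartialOrder P] (n : ℕ) : ∀ S : Finset P, S.card = n →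
    ∃ A : Finset P, A ⊆ S ∧ IsAntichain (· ≤ ·) (A : Set P) ∧ ∃ f : P → ℕ,
      (∀ x ∈ S, f x < A.card) ∧ ∀ x ∈ S, ∀ y ∈ S, f x = f y → x ≤ y ∨ y ≤ x := by
  classical
  induction n using Nat.strong_induction_on with
  | _ n ih =>
  intro S hS
  rcases S.eq_empty_or_nonempty with rfl | hne
  · exact ⟨∅, by simp, by simp, fun _ => 0, by simp, by simp⟩
  obtain ⟨a, ha⟩ := S.exists_maximal hne
  have haS := ha.prop
  have hlt : (S.erase a).card < n := hS ▸ Finset.card_erase_lt_of_mem haS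
  obtain ⟨A0, hA0, hanti0, f, hfk, hf⟩ := ih _ hlt (S.erase a) rfl
  set k := A0.card with hk
  have hit := dil_hit (S.erase a) f k hfk hf
  have hx : ∀ i, ∃ x, i < k → (x ∈ S.erase a ∧ f x = i ∧
      (∃ B : Finset P, B ⊆ S.erase a ∧ IsAntichain (· ≤ ·) (B : Set P) ∧ k ≤ B.card ∧ x ∈ B) ∧
      ∀ B : Finset P, B ⊆ S.erase a → IsAntichain (· ≤ ·) (B : Set P) → k ≤ B.card →
        ∀ y ∈ B, f y = i → y ≤ x) := by
    intro i
    by_cases hi : i < k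
    swap
    · exact ⟨a, fun h => absurd h hi⟩
    let T := (S.erase a).filter (fun x => f x = i ∧
      ∃ B : Finset P, B ⊆ S.erase a ∧ IsAntichain (· ≤ ·) (B : Set P) ∧ k ≤ B.card ∧ x ∈ B)
    have hT : T.Nonempty := by
      obtain ⟨y, hy, hyi⟩ := hit A0 hA0 hanti0 le_rfl i hi
      exact ⟨y, Finset.mem_filter.2 ⟨hA0 hy, hyi, A0, hA0, hanti0, le_rfl, hy⟩⟩
    obtain ⟨x, hxm⟩ := T.exists_maximal hT
    obtain ⟨h1, h2, h3⟩ := Finset.mem_filter.1 hxm.prop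
    refine ⟨x, fun _ => ⟨h1, h2, h3, ?_⟩⟩
    intro B hB hBa hBk y hy hyi
    have hyT : y ∈ T := Finset.mem_filter.2 ⟨hB hy, hyi, B, hB, hBa, hBk, hy⟩
    rcases hf y (hB hy) x h1 (hyi.trans h2.symm) with h | h
    · exact h
    · exact hxm.le_of_ge hyT h
  choose x hx using hx
  by_cases hcase : ∃ i < k, x i ≤ a
  · obtain ⟨i, hi, hia⟩ := hcase
    obtain ⟨hxS, hxi, -, hxmax⟩ := hx i hi
    set R := S.filter (fun z => ¬ (z = a ∨ (f z = i ∧ z ≤ x i))) with hR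
    have hRlt : R.card < n := by
      rw [← hS]
      apply Finset.card_lt_card
      refine ⟨Finset.filter_subset _ _, fun h => ?_⟩
      have := (Finset.mem_filter.1 (h haS)).2
      simp at this
    obtain ⟨A1, hA1, hanti1, f1, hf1k, hf1⟩ := ih _ hRlt R rfl
    have hA1S : A1 ⊆ S.erase a := by
      intro z hz
      have := Finset.mem_filter.1 (hA1 hz)
      exact Finset.mem_erase.2 ⟨fun h => this.2 (Or.inl h), this.1⟩
    have hlt1 : A1.card < k := by
      by_contra hcon
      push Not at hcon
      obtain ⟨y, hy, hyi⟩ := hit A1 hA1S hanti1 hcon i hi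
      have := hxmax A1 hA1S hanti1 hcon y hy hyi
      exact (Finset.mem_filter.1 (hA1 hy)).2 (Or.inr ⟨hyi, this⟩)
    refine ⟨A0, hA0.trans (Finset.erase_subset _ _), hanti0,
      fun z => if z = a ∨ (f z = i ∧ z ≤ x i) then A1.card else f1 z, ?_, ?_⟩
    · intro z hz
      dsimp only
      split_ifs with h
      · exact hlt1
      · exact (hf1k z (Finset.mem_filter.2 ⟨hz, h⟩)).trans hlt1
    · intro z hz w hw
      dsimp only
      split_ifs with h1 h2 h2
      · intro _
        by_cases hza : z = a
        · by_cases hwa : w = a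
          · left; rw [hza, hwa]
          · right; rw [hza]; exact (h2.resolve_left hwa).2.trans hia
        · by_cases hwa : w = a
          · left; rw [hwa]; exact (h1.resolve_left hza).2.trans hia
          · exact hf z (Finset.mem_erase.2 ⟨hza, hz⟩) w (Finset.mem_erase.2 ⟨hwa, hw⟩)
              ((h1.resolve_left hza).1.trans (h2.resolve_left hwa).1.symm)
      · intro h
        have := hf1k w (Finset.mem_filter.2 ⟨hw, h2⟩)
        omega
      · intro h
        have := hf1k z (Finset.mem_filter.2 ⟨hz, h1⟩)
        omega
      · exact hf1 z (Finset.mem_filter.2 ⟨hz, h1⟩) w (Finset.mem_filter.2 ⟨hw, h2⟩)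
  · push Not at hcase
    have hinj : Set.InjOn x (Finset.range k : Set ℕ) := by
      intro i hi j hj h
      have hi : i < k := by simpa using hi
      have hj : j < k := by simpa using hj
      rw [← (hx i hi).2.1, ← (hx j hj).2.1, h]
    have hanot : a ∉ (Finset.range k).image x := by
      intro h
      obtain ⟨i, hi, h⟩ := Finset.mem_image.1 h
      exact hcase i (Finset.mem_range.1 hi) h.le
    have hcard : (insert a ((Finset.range k).image x)).card = k + 1 := by
      rw [Finset.card_insert_of_notMem hanot, Finset.card_image_of_injOn hinj, Finset.card_range]
    refine ⟨insert a ((Finset.range k).image x), ?_, ?_, fun z => if z = a then k else f z, ?_, ?_⟩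
    · intro z hz
      rcases Finset.mem_insert.1 hz with rfl | hz
      · exact haS
      · obtain ⟨i, hi, rfl⟩ := Finset.mem_image.1 hz
        exact Finset.mem_of_mem_erase (hx i (Finset.mem_range.1 hi)).1
    · intro z hz w hw hne hle
      rcases Finset.mem_insert.1 hz with rfl | hz
      · rcases Finset.mem_insert.1 hw with rfl | hw
        · exact hne rfl
        · obtain ⟨j, hj, rfl⟩ := Finset.mem_image.1 hw
          have hj := Finset.mem_range.1 hj
          exact hcase j hj (ha.le_of_ge (Finset.mem_of_mem_erase (hx j hj).1) hle)
      · obtain ⟨i, hi, rfl⟩ := Finset.mem_image.1 hz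
        have hi := Finset.mem_range.1 hi
        rcases Finset.mem_insert.1 hw with rfl | hw
        · exact hcase i hi hle
        · obtain ⟨j, hj, rfl⟩ := Finset.mem_image.1 hw
          have hj := Finset.mem_range.1 hj
          obtain ⟨B, hB, hBa, hBk, hxB⟩ := (hx j hj).2.2.1
          obtain ⟨y, hy, hyi⟩ := hit B hB hBa hBk i hi
          have h1 := (hx i hi).2.2.2 B hB hBa hBk y hy hyi
          have h2 : y = x j := hBa.eq hy hxB (h1.trans hle)
          apply hne
          have : i = j := by rw [← hyi, h2, (hx j hj).2.1]
          rw [this]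
    · intro z hz
      rw [hcard]
      dsimp only
      split_ifs with h
      · omega
      · have := hfk z (Finset.mem_erase.2 ⟨h, hz⟩)
        omega
    · intro z hz w hw
      dsimp only
      split_ifs with h1 h2 h2
      · intro _; left; rw [h1, h2]
      · intro h
        have := hfk w (Finset.mem_erase.2 ⟨h2, hw⟩)
        omega
      · intro h
        have := hfk z (Finset.mem_erase.2 ⟨h1, hz⟩)
        omega
      · exact hf z (Finset.mem_erase.2 ⟨h1, hz⟩) w (Finset.mem_erase.2 ⟨h2, hw⟩)


/-- Dilworth's theorem: in any finite poset `P`, the maximum size of an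
antichain equals the minimum number of chains into which `P` can be
partitioned (a partition into `m` chains being encoded by a function
`P → Fin m` all of whose fibers are chains). -/
theorem dilworth {P : Type*} [PartialOrder P] [Finite P] :
    sSup {m : ℕ | ∃ A : Set P, IsAntichain (· ≤ ·) A ∧ A.ncard = m} =
      sInf {m : ℕ | ∃ f : P → Fin m, ∀ i : Fin m, IsChain (· ≤ ·) (f ⁻¹' {i})} := by
  classical
  haveI := Fintype.ofFinite P
  obtain ⟨A, -, hA, f, hfk, hf⟩ := dil_main _ (Finset.univ : Finset P) rfl
  have hmem : A.card ∈
      {m : ℕ | ∃ f : P → Fin m, ∀ i : Fin m, IsChain (· ≤ ·) (f ⁻¹' {i})} := by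
    refine ⟨fun z => ⟨f z, hfk z (Finset.mem_univ z)⟩, ?_⟩
    intro i z hz w hw _
    apply hf z (Finset.mem_univ z) w (Finset.mem_univ w)
    have hz : _ = i := hz
    have hw : _ = i := hw
    exact congrArg Fin.val (hz.trans hw.symm)
  apply le_antisymm
  · refine csSup_le ⟨A.card, (A : Set P), hA, Set.ncard_coe_finset A⟩ ?_
    rintro m ⟨B, hB, rfl⟩
    obtain ⟨g, hg⟩ := Nat.sInf_mem ⟨_, hmem⟩
    have hinj : Set.InjOn g B := by
      intro z hz w hw h
      by_contra hne
      rcases hg (g w) (show z ∈ _ from h) (show w ∈ _ from rfl) hne with h' | h'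
      · exact hne (hB.eq hz hw h')
      · exact hne (hB.eq hw hz h').symm
    rw [← Set.ncard_image_of_injOn hinj]
    refine (Set.ncard_le_card _).trans ?_
    simp
  · refine (Nat.sInf_le hmem).trans (le_csSup ⟨Nat.card P, ?_⟩ ⟨(A : Set P), hA, Set.ncard_coe_finset A⟩)
    rintro m ⟨B, -, rfl⟩
    exact Set.ncard_le_card B
end

section
/- (Dual of Dilworth's theorem / Mirsky's theorem) For any finite poset P, if P contains no chain of k+1 elements, then P can be partitioned into k antichains; consequently the maximum number of elements in a chain of P equals the minimum number of antichains into which P can be partitioned. -/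
/-- Mirsky's theorem (dual of Dilworth's theorem): in any finite poset `P`,
if `P` contains no chain of `k + 1` elements then `P` can be partitioned into
`k` antichains (a partition into `k` antichains being encoded by a function
`P → Fin k` all of whose fibers are antichains); consequently the maximum
number of elements in a chain of `P` equals the minimum number of antichains
into which `P` can be partitioned. -/
theorem mirsky {P : Type*} [PartialOrder P] [Finite P] :
    (∀ k : ℕ, (∀ c : Set P, IsChain (· ≤ ·) c → c.ncard ≤ k) →
      ∃ f : P → Fin k, ∀ i : Fin k, IsAntichain (· ≤ ·) (f ⁻¹' {i})) ∧
    sSup {m : ℕ | ∃ c : Set P, IsChain (· ≤ ·) c ∧ c.ncard = m} =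
      sInf {m : ℕ | ∃ f : P → Fin m, ∀ i : Fin m, IsAntichain (· ≤ ·) (f ⁻¹' {i})} := by
  have key : ∀ k : ℕ, (∀ c : Set P, IsChain (· ≤ ·) c → c.ncard ≤ k) →
      ∃ f : P → Fin k, ∀ i : Fin k, IsAntichain (· ≤ ·) (f ⁻¹' {i}) := by
    intro k hk
    have hlt : ∀ x : P, Order.height x < (k : ℕ∞) := by
      intro x
      by_contra hx
      obtain ⟨p, -, hp⟩ := Order.exists_series_of_le_height x (not_lt.mp hx)
      have h1 := hk (Set.range p) p.strictMono.monotone.isChain_range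
      have h2 : (Set.range p).ncard = p.length + 1 := by
        rw [← Set.image_univ, Set.ncard_image_of_injective _ p.strictMono.injective,
          Set.ncard_univ, Nat.card_eq_fintype_card, Fintype.card_fin]
      omega
    have htop : ∀ x : P, Order.height x < ⊤ := fun x => (hlt x).trans_le le_top
    refine ⟨fun x => ⟨(Order.height x).toNat, ?_⟩, ?_⟩
    · have h := hlt x
      rw [← ENat.coe_toNat (htop x).ne] at h
      exact_mod_cast h
    · intro i x hx y hy hne hle
      have h := Order.height_strictMono (lt_of_le_of_ne hle hne) (htop x)
      have hxy : (Order.height x).toNat = (Order.height y).toNat :=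
        congrArg Fin.val ((show _ = i from hx).trans (show _ = i from hy).symm)
      rw [← ENat.coe_toNat (htop x).ne, ← ENat.coe_toNat (htop y).ne, hxy] at h
      exact lt_irrefl _ h
  refine ⟨key, ?_⟩
  have hmem : sSup {m : ℕ | ∃ c : Set P, IsChain (· ≤ ·) c ∧ c.ncard = m} ∈
      {m : ℕ | ∃ f : P → Fin m, ∀ i : Fin m, IsAntichain (· ≤ ·) (f ⁻¹' {i})} := by
    refine key _ fun c hc => le_csSup ⟨Nat.card P, ?_⟩ ⟨c, hc, rfl⟩
    rintro _ ⟨d, -, rfl⟩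
    exact Set.ncard_le_card d
  refine le_antisymm ?_ (Nat.sInf_le hmem)
  obtain ⟨f, hf⟩ := Nat.sInf_mem ⟨_, hmem⟩
  refine csSup_le ⟨_, ∅, Set.subsingleton_empty.isChain, rfl⟩ ?_
  rintro _ ⟨c, hc, rfl⟩
  have hinj : Set.InjOn f c := by
    intro x hx y hy hxy
    by_contra hne
    rcases hc hx hy hne with h | h
    · exact hf (f y) hxy rfl hne h
    · exact hf (f y) rfl hxy (Ne.symm hne) h
  rw [← Set.ncard_image_of_injOn hinj]
  exact (Set.ncard_le_card _).trans (by simp)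
end

section
/- The number of parking functions of order n equals (n+1)^{n-1}; that is, the number of functions f from {1,…,n} to {1,…,n} such that for every i with 1 ≤ i ≤ n the set {x : f(x) ≤ i} has at least i elements, equals (n+1)^{n-1}. -/
def PkP (n : ℕ) (h : Fin n → Fin (n+1)) : Prop :=
  ∀ i : ℕ, 1 ≤ i → i ≤ n → i ≤ (Finset.univ.filter fun x : Fin n => (h x : ℕ) + 1 ≤ i).card

def pkT (n : ℕ) (g : Fin n → Fin (n+1)) (k : ℕ) : ℕ :=
  ∑ j ∈ Finset.range k, (Finset.univ.filter fun x : Fin n => (g x : ℕ) = j % (n+1)).card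

lemma pk_sub (n : ℕ) (a s : Fin (n+1)) (i : ℕ) (hi : i < n+1) :
    ((a - s : Fin (n+1)) : ℕ) = i ↔ (a : ℕ) = (s + i) % (n+1) := by
  have ha := a.2
  have hs := s.2
  rw [Fin.val_sub]
  rcases lt_or_ge (n + 1 - (s:ℕ) + a) (n+1) with h | h <;>
  rcases lt_or_ge ((s:ℕ) + i) (n+1) with h' | h'
  · rw [Nat.mod_eq_of_lt h, Nat.mod_eq_of_lt h']; omega
  · rw [Nat.mod_eq_of_lt h, Nat.mod_eq_sub_mod h', Nat.mod_eq_of_lt (by omega)]; omega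
  · rw [Nat.mod_eq_sub_mod h, Nat.mod_eq_of_lt (by omega), Nat.mod_eq_of_lt h']; omega
  · rw [Nat.mod_eq_sub_mod h, Nat.mod_eq_of_lt (by omega), Nat.mod_eq_sub_mod h',
      Nat.mod_eq_of_lt (by omega)]; omega

lemma pk_count (n : ℕ) (g : Fin n → Fin (n+1)) (s : Fin (n+1)) (i : ℕ) (hi : i ≤ n+1) :
    pkT n g (s + i) = pkT n g s +
      (Finset.univ.filter fun x : Fin n => ((g x - s : Fin (n+1)) : ℕ) + 1 ≤ i).card := by
  induction i with
  | zero => simp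
  | succ i ih =>
    have e : (Finset.univ.filter fun x : Fin n => ((g x - s : Fin (n+1)) : ℕ) + 1 ≤ i + 1)
      = (Finset.univ.filter fun x : Fin n => ((g x - s : Fin (n+1)) : ℕ) + 1 ≤ i) ∪
        (Finset.univ.filter fun x : Fin n => (g x : ℕ) = (s + i) % (n+1)) := by
      ext x
      have := pk_sub n (g x) s i (by omega)
      simp only [Finset.mem_filter, Finset.mem_union, Finset.mem_univ, true_and, ← this]
      omega
    rw [e, Finset.card_union_of_disjoint, ← add_assoc (s:ℕ), ← add_assoc (pkT n g s), ← ih (by omega)]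
    · exact Finset.sum_range_succ _ _
    · rw [Finset.disjoint_left]
      intro x
      have := pk_sub n (g x) s i (by omega)
      simp only [Finset.mem_filter, Finset.mem_univ, true_and, ← this]
      omega

lemma pk_period (n : ℕ) (g : Fin n → Fin (n+1)) (k : ℕ) :
    pkT n g (k + (n+1)) = pkT n g k + n := by
  induction k with
  | zero =>
    have := pk_count n g 0 (n+1) le_rfl
    simp only [Fin.val_zero] at this
    rw [this, Finset.filter_true_of_mem]
    · simp
    · intro x _
      have := (g x - 0).2
      omega
  | succ k ih =>
    have e : k + 1 + (n+1) = (k + (n+1)) + 1 := by ring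
    have h1 := Finset.sum_range_succ (fun j => (Finset.univ.filter fun x : Fin n => (g x : ℕ) = j % (n+1)).card) (k + (n+1))
    have h2 := Finset.sum_range_succ (fun j => (Finset.univ.filter fun x : Fin n => (g x : ℕ) = j % (n+1)).card) k
    simp only [Nat.add_mod_right] at h1
    simp only [pkT] at *
    rw [e]
    omega

lemma pk_iff (n : ℕ) (g : Fin n → Fin (n+1)) (s : Fin (n+1)) :
    PkP n (fun x => g x - s) ↔ ∀ i, 1 ≤ i → i ≤ n → pkT n g s + i ≤ pkT n g (s + i) := by
  refine forall_congr' fun i => forall_congr' fun _ => forall_congr' fun h => ?_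
  rw [pk_count n g s i (by omega)]
  exact (Nat.add_le_add_iff_left).symm

lemma pk_unique (n : ℕ) (g : Fin n → Fin (n+1)) (s t : Fin (n+1))
    (hs : PkP n (fun x => g x - s)) (ht : PkP n (fun x => g x - t)) (hlt : (s:ℕ) < t) : False := by
  rw [pk_iff] at hs ht
  have h1 := hs (t - s) (by omega) (by omega)
  have h2 := ht (s + (n+1) - t) (by omega) (by omega)
  rw [show (s:ℕ) + (t - s) = t by omega] at h1
  rw [show (t:ℕ) + (s + (n+1) - t) = s + (n+1) by omega, pk_period] at h2
  omega

lemma pk_exists (n : ℕ) (g : Fin n → Fin (n+1)) : ∃ s, PkP n (fun x => g x - s) := by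
  -- minimise the pair (S, position) lexicographically
  obtain ⟨s, -, hs⟩ := Finset.exists_min_image (Finset.univ : Finset (Fin (n+1)))
    (fun s => ((n:ℤ)+1) * ((pkT n g s : ℤ) - (s:ℕ)) + (s:ℕ)) ⟨0, by simp⟩
  have key : ∀ t : Fin (n+1), (pkT n g s : ℤ) - (s:ℕ) ≤ (pkT n g t : ℤ) - (t:ℕ) ∧
      ((t:ℕ) < s → (pkT n g s : ℤ) - (s:ℕ) < (pkT n g t : ℤ) - (t:ℕ)) := by
    intro t
    have h := hs t (Finset.mem_univ _)
    have h1 := s.2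
    have h2 := t.2
    generalize (pkT n g s : ℤ) - (s:ℕ) = a at *
    generalize (pkT n g t : ℤ) - (t:ℕ) = b at *
    constructor
    · by_contra hc
      have : b + 1 ≤ a := by omega
      have : ((n:ℤ)+1) * (b+1) ≤ (n+1) * a := by gcongr
      rw [mul_add] at this
      omega
    · intro hlt
      by_contra hc
      have : b ≤ a := by omega
      have : ((n:ℤ)+1) * b ≤ (n+1) * a := by gcongr
      omega
  refine ⟨s, (pk_iff n g s).2 fun i h1 h2 => ?_⟩
  have h3 := s.2
  rcases lt_or_ge ((s:ℕ) + i) (n+1) with h | h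
  · have := (key ⟨s + i, h⟩).1
    simp only at this
    push_cast at this
    omega
  · have := (key ⟨s + i - (n+1), by omega⟩).2 (by simp only; omega)
    have h4 := pk_period n g (s + i - (n+1))
    rw [show (s:ℕ) + i - (n+1) + (n+1) = s + i by omega] at h4
    simp only at this
    omega

lemma pk_card (n : ℕ) (hn : 1 ≤ n) : Nat.card {h // PkP n h} = (n+1)^(n-1) := by
  have hb : Function.Bijective
      (fun p : {h // PkP n h} × Fin (n+1) => fun x => p.1.1 x + p.2) := by
    constructor
    · rintro ⟨⟨p, hp⟩, s⟩ ⟨⟨q, hq⟩, t⟩ h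
      simp only at h
      have e1 : (fun x => (p x + s) - s) = p := by ext x; simp
      have e2 : (fun x => (p x + s) - t) = q := by
        ext x; rw [congrFun h x]; simp
      have hst : s = t := by
        by_contra hne
        rcases lt_or_gt_of_ne hne with hl | hl
        · exact pk_unique n (fun x => p x + s) s t (by simpa only [e1]) (by simpa only [e2]) hl
        · exact pk_unique n (fun x => p x + s) t s (by simpa only [e2]) (by simpa only [e1]) hl
      subst hst
      have : p = q := e1.symm.trans e2
      subst this
      rfl
    · intro g
      obtain ⟨s, hs⟩ := pk_exists n g
      exact ⟨(⟨_, hs⟩, s), by ext x; simp⟩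
  have h := Nat.card_eq_of_bijective _ hb
  rw [Nat.card_prod] at h
  simp only [Nat.card_eq_fintype_card, Fintype.card_fin, Fintype.card_pi, Finset.prod_const,
    Finset.card_univ] at h
  obtain ⟨m, rfl⟩ : ∃ m, n = m + 1 := ⟨n - 1, by omega⟩
  rw [pow_succ] at h
  exact Nat.eq_of_mul_eq_mul_right (by omega) h


/-- The number of parking functions of order `n` equals `(n+1)^(n-1)`.
A parking function of order `n` is a function `f : {1,…,n} → {1,…,n}`
(encoded as `f : Fin n → Fin n`, where the value `f x` represents the parking
spot `(f x) + 1 ∈ {1,…,n}`) such that for every `i` with `1 ≤ i ≤ n` the set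
`{x | f x ≤ i}` has at least `i` elements. -/
theorem card_parking_functions (n : ℕ) (hn : 1 ≤ n) :
    Nat.card {f : Fin n → Fin n //
        ∀ i : ℕ, 1 ≤ i → i ≤ n →
          i ≤ (Finset.univ.filter fun x : Fin n => (f x : ℕ) + 1 ≤ i).card} =
      (n + 1) ^ (n - 1) := by
  rw [← pk_card n hn]
  refine Nat.card_eq_of_bijective
    (fun f => ⟨fun x => (f.1 x).castSucc, fun i h1 h2 => by simpa using f.2 i h1 h2⟩) ⟨?_, ?_⟩
  · rintro ⟨f, hf⟩ ⟨g, hg⟩ h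
    have h' := congrArg Subtype.val h
    apply Subtype.ext
    funext x
    exact Fin.castSucc_injective _ (congrFun h' x)
  · rintro ⟨h, hh⟩
    have hl : ∀ x, (h x : ℕ) < n := by
      have h1 := hh n hn le_rfl
      have h2 : (Finset.univ.filter fun x : Fin n => (h x : ℕ) + 1 ≤ n) = Finset.univ := by
        apply Finset.eq_univ_of_card
        apply le_antisymm (Finset.card_le_univ _)
        simpa using h1
      intro x
      have := Finset.mem_univ x
      rw [← h2] at this
      simpa using this
    exact ⟨⟨fun x => ⟨h x, hl x⟩, hh⟩, rfl⟩
end
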